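/- Let n ≥ 5 and let k be an integer with 2 ≤ k ≤ ⌊n/2⌋. If n is even and k is odd, then mbt(C(n,k)) = Δ(C(n,k)) (C(n,k) is dispersable); in every other case, mbt(C(n,k)) = Δ(C(n,k)) + 1 (C(n,k) is nearly dispersable). Equivalently, C(n,k) is dispersable if and only if it is bipartite, and otherwise it is nearly dispersable. -/

import Mathlib

open SimpleGraph

/-- The circulant graph `C(ℤ_n, S)`: vertices are `ZMod n`, and distinct `i, j` are
adjacent iff `i - j ≡ s` or `i - j ≡ -s (mod n)` for some `s ∈ S`. -/
def circulant (n : ℕ) (S : Set ℤ) : SimpleGraph (ZMod n) :=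
  SimpleGraph.fromRel fun i j => ∃ s ∈ S, i - j = (s : ZMod n)

/-- `C(n,k) = C(ℤ_n, {1, k})`. -/
def circ (n k : ℕ) : SimpleGraph (ZMod n) := circulant n {1, (k : ℤ)}

/-- The maximum degree `Δ(G)` of a graph. -/
noncomputable def maxDeg {V : Type*} (G : SimpleGraph V) : ℕ :=
  sSup (Set.range fun v => (G.neighborSet v).ncard)

/-- `x` lies strictly between positions `a` and `b` on the circular layout
(cut open along the linear order of `Fin N`). -/
def ChordBetween {N : ℕ} (x a b : Fin N) : Prop := min a b < x ∧ x < max a b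

/-- The chords joining the positions `a,b` and `c,d` on a circle cross iff exactly one of
`c, d` lies strictly between `a` and `b`. -/
def ChordCross {N : ℕ} (a b c d : Fin N) : Prop :=
  Xor' (ChordBetween c a b) (ChordBetween d a b)

/-- `G` admits a matching book embedding in `m` pages: there is a circular layout
(a bijection of the vertices with `Fin (Nat.card V)`) and a proper edge coloring with
`m` colors such that crossing edges get distinct colors. -/
def HasMBE {V : Type*} (G : SimpleGraph V) (m : ℕ) : Prop :=
  ∃ (σ : V ≃ Fin (Nat.card V)) (col : V → V → Fin m),
    (∀ u v, G.Adj u v → col u v = col v u) ∧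
    (∀ u v w, G.Adj u v → G.Adj u w → v ≠ w → col u v ≠ col u w) ∧
    (∀ a b c d, G.Adj a b → G.Adj c d →
      ChordCross (σ a) (σ b) (σ c) (σ d) → col a b ≠ col c d)

/-- The matching book thickness `mbt(G)`. -/
noncomputable def mbt {V : Type*} (G : SimpleGraph V) : ℕ :=
  sInf {m | HasMBE G m}

/-- The remainder algorithm from the paper: `k₀ = k`, `r₀ = r`,
`k_{i+1} = k_i - r_i`, `r_{i+1} = k_i mod k_{i+1}`. -/
def euclidSeq (k r : ℕ) : ℕ → ℕ × ℕ
  | 0 => (k, r)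
  | i + 1 =>
      ((euclidSeq k r i).1 - (euclidSeq k r i).2,
       (euclidSeq k r i).1 % ((euclidSeq k r i).1 - (euclidSeq k r i).2))


def MGood {α : Type*} [LinearOrder α] (a b c d : α) : Prop :=
  (a = c ∧ b = d) ∨ (a = d ∧ b = c) ∨
    (a ≠ c ∧ a ≠ d ∧ b ≠ c ∧ b ≠ d ∧
      ¬ Xor (min a b < c ∧ c < max a b) (min a b < d ∧ d < max a b))

theorem MGood.swap1 {α : Type*} [LinearOrder α] {a b c d : α} (h : MGood a b c d) :
    MGood b a c d := by
  unfold MGood at *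
  rw [min_comm b a, max_comm b a]
  tauto

theorem MGood.swap2 {α : Type*} [LinearOrder α] {a b c d : α} (h : MGood a b c d) :
    MGood a b d c := by
  unfold MGood at *
  rw [_root_.xor_comm (min a b < d ∧ d < max a b)]
  tauto

theorem hasMBE_of {V : Type*} [Finite V] (G : SimpleGraph V) (m : ℕ) (hm : 0 < m)
    {α : Type*} [LinearOrder α] (pos : V → α) (inj : Function.Injective pos)
    (E : V → V → ℕ → Prop)
    (hadj : ∀ u v, G.Adj u v → ∃ c < m, E u v c ∨ E v u c)
    (hgood : ∀ u v u' v' c, E u v c → E u' v' c → MGood (pos u) (pos v) (pos u') (pos v')) :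
    HasMBE G m := by
  classical
  have : Fintype V := Fintype.ofFinite V
  let _ : LinearOrder V := LinearOrder.lift' pos inj
  have hlt : ∀ u v : V, u < v ↔ pos u < pos v := fun u v => Iff.rfl
  let e := (monoEquivOfFin V (Nat.card_eq_fintype_card (α := V)).symm).symm
  have key : ∀ u v, G.Adj u v → ∃ c : Fin m, ∃ a b, s(a, b) = s(u, v) ∧ E a b c := by
    intro u v h
    obtain ⟨c, hc, h | h⟩ := hadj u v h
    · exact ⟨⟨c, hc⟩, u, v, rfl, h⟩
    · exact ⟨⟨c, hc⟩, v, u, Sym2.eq_swap, h⟩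
  have : NeZero m := ⟨hm.ne'⟩
  let col : V → V → Fin m := fun u v =>
    if h : ∃ c : Fin m, ∃ a b, s(a, b) = s(u, v) ∧ E a b c then h.choose else 0
  have hcol : ∀ u v, G.Adj u v → ∃ a b, s(a, b) = s(u, v) ∧ E a b (col u v) := by
    intro u v h
    have h' := key u v h
    simp only [col, dif_pos h']
    exact h'.choose_spec
  have mm : ∀ u v u' v', G.Adj u v → G.Adj u' v' → col u v = col u' v' →
      MGood (pos u) (pos v) (pos u') (pos v') := by
    intro u v u' v' h h' hc
    obtain ⟨a, b, hab, hE⟩ := hcol u v h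
    obtain ⟨a', b', hab', hE'⟩ := hcol u' v' h'
    rw [hc] at hE
    have := hgood _ _ _ _ _ hE hE'
    rw [Sym2.eq_iff] at hab hab'
    rcases hab with ⟨rfl, rfl⟩ | ⟨rfl, rfl⟩ <;> rcases hab' with ⟨rfl, rfl⟩ | ⟨rfl, rfl⟩
    · exact this
    · exact this.swap2
    · exact this.swap1
    · exact this.swap1.swap2
  refine ⟨e.toEquiv, col, ?_, ?_, ?_⟩
  · intro u v _
    simp only [col, Sym2.eq_swap (a := v) (b := u)]
  · intro u v w h1 h2 hne hc
    have := mm _ _ _ _ h1 h2 hc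
    rcases this with ⟨_, h⟩ | ⟨h, h'⟩ | h
    · exact hne (inj h)
    · exact hne (inj (h'.trans h))
    · exact h.1 rfl
  · intro a b c d h1 h2 hx hc
    have := mm _ _ _ _ h1 h2 hc
    have elt : ∀ u v, e u < e v ↔ pos u < pos v := fun u v => by
      rw [← hlt]; exact e.lt_iff_lt
    have ele : ∀ u v, ChordBetween (e c) (e u) (e v) ↔ (min (pos u) (pos v) < pos c ∧ pos c < max (pos u) (pos v)) := by
      intro u v
      simp only [ChordBetween, min_lt_iff, lt_max_iff, elt]
    have ele' : ∀ u v, ChordBetween (e d) (e u) (e v) ↔ (min (pos u) (pos v) < pos d ∧ pos d < max (pos u) (pos v)) := by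
      intro u v
      simp only [ChordBetween, min_lt_iff, lt_max_iff, elt]
    have hx' : Xor (ChordBetween (e c) (e a) (e b)) (ChordBetween (e d) (e a) (e b)) := hx
    rw [ele, ele'] at hx'
    rcases this with ⟨h, h'⟩ | ⟨h, h'⟩ | h
    · rw [← h, ← h'] at hx'
      rcases hx' with hx' | hx' <;> simp at hx'
      · exact lt_asymm hx'.1.1 hx'.1.2
      · exact lt_asymm hx'.1.1 hx'.1.2
    · rw [← h, ← h'] at hx'
      rcases hx' with hx' | hx' <;> simp at hx'
      · exact lt_asymm hx'.1.1 hx'.1.2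
      · exact lt_asymm hx'.1.1 hx'.1.2
    · exact h.2.2.2.2 hx'

theorem circ_adj (n k : ℕ) (u v : ZMod n) : (circ n k).Adj u v ↔
    u ≠ v ∧ (v = u + 1 ∨ v = u + k ∨ u = v + 1 ∨ u = v + k) := by
  unfold circ circulant
  rw [SimpleGraph.fromRel_adj]
  simp only [Set.mem_insert_iff, Set.mem_singleton_iff, exists_eq_or_imp, exists_eq_left,
    Int.cast_one, Int.cast_natCast, sub_eq_iff_eq_add]
  rw [add_comm u 1, add_comm u (k : ZMod n), add_comm v 1, add_comm v (k : ZMod n)]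
  tauto

theorem deg_le_of_hasMBE {V : Type*} [Finite V] (G : SimpleGraph V) (m : ℕ) (h : HasMBE G m)
    (v : V) : (G.neighborSet v).ncard ≤ m := by
  obtain ⟨σ, col, h1, h2, h3⟩ := h
  have : Set.InjOn (col v) (G.neighborSet v) := by
    intro a ha b hb hab
    by_contra hne
    exact h2 v a b ha hb hne hab
  rw [← this.ncard_image]
  calc _ ≤ Nat.card (Fin m) := Set.ncard_le_card _
    _ = m := by simp

theorem parity_of_hasMBE {V : Type*} [Finite V] (G : SimpleGraph V) (m : ℕ) (h : HasMBE G m)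
    (hreg : ∀ v, (G.neighborSet v).ncard = m) :
    ∃ f : V → ZMod 2, ∀ u v, G.Adj u v → f v = f u + 1 := by
  classical
  have : Fintype V := Fintype.ofFinite V
  obtain ⟨σ, col, h1, h2, h3⟩ := h
  have hex : ∀ v c, ∃ w, G.Adj v w ∧ col v w = c := by
    intro v c
    have hi : Set.InjOn (col v) (G.neighborSet v) := by
      intro a ha b hb hab
      by_contra hne
      exact h2 v a b ha hb hne hab
    have : (col v '' (G.neighborSet v)) = Set.univ := by
      apply Set.eq_of_subset_of_ncard_le (Set.subset_univ _)
      rw [hi.ncard_image, hreg]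
      simp [Set.ncard_univ]
    have hc : c ∈ (col v '' (G.neighborSet v)) := by rw [this]; trivial
    obtain ⟨w, hw, hw'⟩ := hc
    exact ⟨w, hw, hw'⟩
  choose M hM hMc using hex
  have hMM : ∀ v c, M (M v c) c = v := by
    intro v c
    by_contra hne
    exact h2 (M v c) _ v (hM _ c) (hM v c).symm hne (by rw [hMc, ← h1 _ _ (hM v c), hMc])
  have main : ∀ u v, G.Adj u v → σ u < σ v →
      ((σ v : ℕ) : ZMod 2) = ((σ u : ℕ) : ZMod 2) + 1 := by
    intro u v huv hlt
    set c := col u v with hc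
    set S : Finset V := Finset.univ.filter (fun w => σ u < σ w ∧ σ w < σ v) with hS
    have hb : ∀ w, ChordBetween (σ w) (σ u) (σ v) ↔ w ∈ S := by
      intro w
      simp [ChordBetween, hS, min_eq_left hlt.le, max_eq_right hlt.le]
    have hMS : ∀ w ∈ S, M w c ∈ S := by
      intro w hw
      by_contra hn
      refine h3 u v w (M w c) huv (hM w c) ?_ (hMc w c).symm
      left
      rw [hb, hb]
      exact ⟨hw, hn⟩
    have hsum : ∑ w ∈ S, (1 : ZMod 2) = 0 := by
      apply Finset.sum_involution (fun w _ => M w c)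
      · intro w hw
        decide
      · intro w hw _ he
        exact (hM w c).ne he.symm
      · intro w hw
        exact hMS w hw
      · intro w hw
        exact hMM w c
    have hcard : S.card = (σ v : ℕ) - σ u - 1 := by
      have : S.map σ.toEmbedding = Finset.Ioo (σ u) (σ v) := by
        ext x
        simp only [hS, Finset.mem_map_equiv, Finset.mem_filter, Finset.mem_univ, true_and,
          Equiv.apply_symm_apply, Finset.mem_Ioo]
      rw [← Finset.card_map σ.toEmbedding, this, Fin.card_Ioo]
    rw [Finset.sum_const, nsmul_eq_mul, mul_one, hcard] at hsum
    have hl : (σ u : ℕ) < σ v := hlt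
    have : (σ v : ℕ) = (σ v - σ u - 1) + σ u + 1 := by omega
    rw [this]
    push_cast
    rw [hsum]
    ring
  refine ⟨fun v => ((σ v : ℕ) : ZMod 2), fun u v h => ?_⟩
  rcases lt_trichotomy (σ u) (σ v) with hl | hl | hl
  · exact main u v h hl
  · exact absurd (σ.injective hl) h.ne
  · have := main v u h.symm hl
    show ((σ v : ℕ) : ZMod 2) = ((σ u : ℕ) : ZMod 2) + 1
    rw [this, add_assoc]
    have : (1 : ZMod 2) + 1 = 0 := by decide
    rw [this, add_zero]

theorem natCast_ne_zero' (n a : ℕ) (h0 : 0 < a) (h : a < n) : (a : ZMod n) ≠ 0 := by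
  rw [Ne, ZMod.natCast_eq_zero_iff]
  exact Nat.not_dvd_of_pos_of_lt h0 h

theorem bip_of_parity (n k : ℕ) (hn : 5 ≤ n) (hk : 2 ≤ k) (hk' : k ≤ n / 2)
    (f : ZMod n → ZMod 2) (hf : ∀ u v, (circ n k).Adj u v → f v = f u + 1) :
    Even n ∧ Odd k := by
  have : NeZero n := ⟨by omega⟩
  have h1 : ∀ i : ℕ, f i = f 0 + i := by
    intro i
    induction i with
    | zero => simp
    | succ i ih =>
      have : (circ n k).Adj (i : ZMod n) ((i + 1 : ℕ) : ZMod n) := by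
        rw [circ_adj]
        refine ⟨?_, Or.inl (by push_cast; rfl)⟩
        intro h
        have : ((1 : ℕ) : ZMod n) ≠ 0 := natCast_ne_zero' n 1 (by omega) (by omega)
        apply this
        push_cast at h ⊢
        exact (left_eq_add.mp h)
      rw [hf _ _ this, ih]
      push_cast
      ring
  constructor
  · have := h1 n
    rw [ZMod.natCast_self, left_eq_add, ZMod.natCast_eq_zero_iff] at this
    exact even_iff_two_dvd.mpr this
  · have h2 := h1 k
    have : (circ n k).Adj 0 (k : ZMod n) := by
      rw [circ_adj]
      refine ⟨?_, Or.inr (Or.inl (by simp))⟩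
      exact (natCast_ne_zero' n k (by omega) (by omega)).symm
    rw [hf _ _ this] at h2
    have h3 := add_left_cancel h2
    have : ((1 : ℕ) : ZMod 2) = k := by simpa using h3
    rw [ZMod.natCast_eq_natCast_iff'] at this
    rw [Nat.odd_iff]
    omega

def Dg (n k : ℕ) : ℕ := if n = 2 * k then 3 else 4

theorem circ_deg (n k : ℕ) (hn : 5 ≤ n) (hk : 2 ≤ k) (hk' : k ≤ n / 2) (v : ZMod n) :
    ((circ n k).neighborSet v).ncard = Dg n k := by
  have hset : (circ n k).neighborSet v = (fun x => v + x) '' {1, -1, (k : ZMod n), -(k : ZMod n)} := by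
    ext w
    simp only [SimpleGraph.mem_neighborSet, circ_adj, Set.image_insert_eq, Set.image_singleton,
      Set.mem_insert_iff, Set.mem_singleton_iff]
    have e1 : v = w + 1 ↔ w = v + -1 := by
      constructor
      · rintro rfl; ring
      · rintro rfl; ring
    have e2 : v = w + k ↔ w = v + -(k : ZMod n) := by
      constructor
      · rintro rfl; ring
      · rintro rfl; ring
    rw [e1, e2]
    constructor
    · tauto
    · intro h
      refine ⟨?_, by tauto⟩
      have a1 : (1 : ZMod n) ≠ 0 := by
        have := natCast_ne_zero' n 1 (by omega) (by omega)
        simpa using this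
      have a2 : (k : ZMod n) ≠ 0 := natCast_ne_zero' n k (by omega) (by omega)
      rintro rfl
      simp only [left_eq_add, neg_eq_zero] at h
      tauto
  rw [hset, Set.ncard_image_of_injective _ (add_right_injective v)]
  have b1 : (1 : ZMod n) ≠ -1 := by
    have := natCast_ne_zero' n 2 (by omega) (by omega)
    intro h
    apply this
    have h2 : (1 : ZMod n) + 1 = 0 := by nth_rewrite 1 [h]; ring
    push_cast
    rw [← h2]; norm_num
  have b2 : (1 : ZMod n) ≠ k := by
    have := natCast_ne_zero' n (k - 1) (by omega) (by omega)
    intro h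
    apply this
    rw [Nat.cast_sub (by omega), ← h]; simp
  have b3 : (1 : ZMod n) ≠ -k := by
    have := natCast_ne_zero' n (k + 1) (by omega) (by omega)
    intro h
    apply this
    push_cast
    rw [h]; simp
  have b4 : (-1 : ZMod n) ≠ k := fun h => b3 (by rw [← h]; simp)
  have b5 : (-1 : ZMod n) ≠ -k := fun h => b2 (by simpa using h)
  unfold Dg
  split_ifs with h
  · have : -(k : ZMod n) = k := by
      rw [neg_eq_iff_add_eq_zero]
      have : ((2 * k : ℕ) : ZMod n) = 0 := by rw [← h]; simp
      push_cast at this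
      rw [← this]; ring
    rw [this, Set.pair_eq_singleton]
    rw [Set.ncard_eq_toFinset_card']
    simp [b1, b2, b4]
  · have b6 : (k : ZMod n) ≠ -k := by
      intro he
      have := natCast_ne_zero' n (2 * k) (by omega) (by omega)
      apply this
      push_cast
      rw [two_mul]
      nth_rewrite 1 [he]
      simp
    rw [Set.ncard_eq_toFinset_card']
    simp [b1, b2, b3, b4, b5, b6]

theorem final_of (n k : ℕ) (hn : 5 ≤ n) (hk : 2 ≤ k) (hk' : k ≤ n / 2)
    (H1 : Even n ∧ Odd k → HasMBE (circ n k) (Dg n k))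
    (H2 : ¬(Even n ∧ Odd k) → HasMBE (circ n k) (Dg n k + 1)) :
    (Even n ∧ Odd k → mbt (circ n k) = maxDeg (circ n k)) ∧
    (¬(Even n ∧ Odd k) → mbt (circ n k) = maxDeg (circ n k) + 1) ∧
    (mbt (circ n k) = maxDeg (circ n k) ↔ Even n ∧ Odd k) := by
  have : NeZero n := ⟨by omega⟩
  have hmd : maxDeg (circ n k) = Dg n k := by
    unfold maxDeg
    simp only [circ_deg n k hn hk hk', Set.range_const, csSup_singleton]
  have hlow : ∀ m, HasMBE (circ n k) m → Dg n k ≤ m := fun m hm => by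
    rw [← circ_deg n k hn hk hk' 0]
    exact deg_le_of_hasMBE _ m hm 0
  have g1 : Even n ∧ Odd k → mbt (circ n k) = maxDeg (circ n k) := by
    intro h
    rw [hmd]
    apply le_antisymm
    · exact Nat.sInf_le (H1 h)
    · exact le_csInf ⟨_, H1 h⟩ hlow
  have g2 : ¬(Even n ∧ Odd k) → mbt (circ n k) = maxDeg (circ n k) + 1 := by
    intro h
    rw [hmd]
    apply le_antisymm
    · exact Nat.sInf_le (H2 h)
    · refine le_csInf ⟨_, H2 h⟩ ?_
      intro m hm
      rcases (hlow m hm).eq_or_lt with he | he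
      · exfalso
        subst he
        obtain ⟨f, hf⟩ := parity_of_hasMBE _ _ hm (circ_deg n k hn hk hk')
        exact h (bip_of_parity n k hn hk hk' f hf)
      · exact he
  refine ⟨g1, g2, ?_, g1⟩
  intro h
  by_contra hne
  have := g2 hne
  omega

theorem mgood_nat {a b c d : ℕ} (h : (a = c ∧ b = d) ∨ (a = d ∧ b = c) ∨
    (a ≠ c ∧ a ≠ d ∧ b ≠ c ∧ b ≠ d ∧
      ((((a < c ∧ c < b) ∨ (b < c ∧ c < a)) ∧ ((a < d ∧ d < b) ∨ (b < d ∧ d < a))) ∨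
       ((¬ (a < c ∧ c < b) ∧ ¬ (b < c ∧ c < a)) ∧ (¬ (a < d ∧ d < b) ∧ ¬ (b < d ∧ d < a)))))) :
    MGood a b c d := by
  rcases h with h | h | ⟨h1, h2, h3, h4, h⟩
  · exact Or.inl h
  · exact Or.inr (Or.inl h)
  · refine Or.inr (Or.inr ⟨h1, h2, h3, h4, ?_⟩)
    simp only [Xor, lt_max_iff, min_lt_iff]
    omega

/-- two chords with the same endpoint sum modulo `N` -/
theorem mgood_sum {N s a b c d : ℕ} (ha : a < N) (hb : b < N) (hc : c < N) (hd : d < N)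
    (h1 : a + b = s ∨ a + b = s + N) (h2 : c + d = s ∨ c + d = s + N) : MGood a b c d := by
  apply mgood_nat
  rcases h1 with h1 | h1 <;> rcases h2 with h2 | h2 <;> omega

/-- cyclically adjacent positions -/
def Cadj (N a b : ℕ) : Prop := b = a + 1 ∨ a = b + 1 ∨ (a = 0 ∧ b + 1 = N) ∨ (b = 0 ∧ a + 1 = N)

theorem mgood_adj {N a b c d : ℕ} (_ : a < N) (_ : b < N) (hc : c < N) (hd : d < N)
    (h : Cadj N a b) (h1 : a ≠ c) (h2 : a ≠ d) (h3 : b ≠ c) (h4 : b ≠ d) : MGood a b c d := by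
  apply mgood_nat
  unfold Cadj at h
  omega

theorem MGood.symm {α : Type*} [LinearOrder α] {a b c d : α} (hab : a ≠ b) (hcd : c ≠ d)
    (h : MGood a b c d) : MGood c d a b := by
  unfold MGood Xor at *
  simp only [lt_max_iff, min_lt_iff] at *
  grind

/-- the abstract data of the relatively prime odd case -/
structure AB (n m s0 s1 s2 s3 : ℕ) (p : ℕ → ℕ) : Prop where
  hn : n % 2 = 1
  hm : m % 2 = 0
  m0 : 0 < m
  mn : m < n
  lt : ∀ t < n, p t < n
  inj : ∀ t < n, ∀ r < n, p t = p r → t = r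
  k0 : ∀ t, t + 1 < n → t % 2 = 0 → p t + p (t + 1) = s0 ∨ p t + p (t + 1) = s0 + n
  k1 : ∀ t, t + 1 < n → t % 2 = 1 → p t + p (t + 1) = s1 ∨ p t + p (t + 1) = s1 + n
  c2 : ∀ t, t < n → n ≤ t + m → t % 2 = 0 →
    p t + p (t + m - n) = s2 ∨ p t + p (t + m - n) = s2 + n
  c3 : ∀ t, t < n → n ≤ t + m → t % 2 = 1 →
    p t + p (t + m - n) = s3 ∨ p t + p (t + m - n) = s3 + n
  ad : ∀ t, t + m < n → Cadj n (p t) (p (t + m))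

/-- conclusion of the combinatorial part -/
def ABC (n m : ℕ) (p : ℕ → ℕ) : Prop :=
  ∃ E : ℕ → ℕ → ℕ → Prop,
    (∀ t, t + 1 < n → ∃ c < 5, E t (t + 1) c) ∧ (∃ c < 5, E (n - 1) 0 c) ∧
    (∀ t, t + m < n → ∃ c < 5, E t (t + m) c) ∧
    (∀ t, t < n → n ≤ t + m → ∃ c < 5, E t (t + m - n) c) ∧
    (∀ t t' r r' c, E t t' c → E r r' c → MGood (p t) (p t') (p r) (p r'))

theorem AB.good_adj {n m s0 s1 s2 s3 : ℕ} {p : ℕ → ℕ} (H : AB n m s0 s1 s2 s3 p)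
    {t r r' : ℕ} (ht : t + m < n) (hr : r < n) (hr' : r' < n)
    (h : (t = r ∧ t + m = r') ∨ (t ≠ r ∧ t ≠ r' ∧ t + m ≠ r ∧ t + m ≠ r')) :
    MGood (p t) (p (t + m)) (p r) (p r') := by
  rcases h with ⟨h1, h2⟩ | ⟨h1, h2, h3, h4⟩
  · subst h1 h2
    left; exact ⟨rfl, rfl⟩
  · have q := H.inj
    exact mgood_adj (H.lt _ (by omega)) (H.lt _ ht) (H.lt _ hr) (H.lt _ hr') (H.ad t ht)
      (fun e => h1 (q _ (by omega) _ (by omega) e)) (fun e => h2 (q _ (by omega) _ (by omega) e))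
      (fun e => h3 (q _ (by omega) _ (by omega) e)) (fun e => h4 (q _ (by omega) _ (by omega) e))

theorem AB.good_adj' {n m s0 s1 s2 s3 : ℕ} {p : ℕ → ℕ} (H : AB n m s0 s1 s2 s3 p)
    {t r r' : ℕ} (ht : t + m < n) (hr : r < n) (hr' : r' < n) (hrr : r ≠ r')
    (h : (t = r ∧ t + m = r') ∨ (t ≠ r ∧ t ≠ r' ∧ t + m ≠ r ∧ t + m ≠ r')) :
    MGood (p r) (p r') (p t) (p (t + m)) := by
  have m0 := H.m0
  apply MGood.symm _ _ (H.good_adj ht hr hr' h)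
  · exact fun e => absurd (H.inj _ (by omega) _ (by omega) e) (by omega)
  · exact fun e => hrr (H.inj _ hr _ hr' e)

set_option maxHeartbeats 4000000 in
/-- case II : `2 m < n` -/
theorem AB.caseII {n m s0 s1 s2 s3 : ℕ} {p : ℕ → ℕ} (H : AB n m s0 s1 s2 s3 p)
    (h2m : 2 * m < n) : ABC n m p := by
  obtain ⟨f, hf1, hf2⟩ : ∃ f : ℕ → ℕ, (∀ t, t + m < n → f t + f (t + m) = 1) ∧
      (∀ t, t < n → n ≤ t + m → f t = 0) := by
    have m0 := H.m0
    refine ⟨fun t => ((n - 1 - t) / m) % 2, ?_, ?_⟩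
    · intro t ht
      have : n - 1 - t = (n - 1 - (t + m)) + m := by omega
      simp only
      rw [this, Nat.add_div_right _ m0]
      omega
    · intro t ht h
      simp only
      rw [Nat.div_eq_of_lt (by omega)]
  have hn := H.hn
  have hm := H.hm
  have m0 := H.m0
  refine ⟨fun t t' c =>
    (c = 0 ∧ t' = t + 1 ∧ t' < n ∧ t % 2 = 0) ∨
    (c = 1 ∧ t' = t + 1 ∧ t' < n ∧ t % 2 = 1) ∨
    (c = 4 ∧ t = n - 1 ∧ t' = 0) ∨
    (c = 2 ∧ t < n ∧ n ≤ t + m ∧ t' = t + m - n ∧ t % 2 = 0) ∨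
    (c = 3 ∧ t < n ∧ n ≤ t + m ∧ t' = t + m - n ∧ t % 2 = 1) ∨
    (c = 2 ∧ t' = t + m ∧ t' < n ∧ (t = 0 ∨ (t % 2 = 0 ∧ t ≠ m ∧ f t = 0) ∨
      (t % 2 = 1 ∧ m ≤ t ∧ f t = 1))) ∨
    (c = 3 ∧ t' = t + m ∧ t' < n ∧ ((t % 2 = 0 ∧ m ≤ t ∧ f t = 1) ∨ (t % 2 = 1 ∧ f t = 0))) ∨
    (c = 4 ∧ t' = t + m ∧ t' < n ∧ ((0 < t ∧ t < m ∧ f t = 1) ∨ (t = m ∧ f t = 0))),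
    ?_, ?_, ?_, ?_, ?_⟩
  · intro t ht
    rcases Nat.mod_two_eq_zero_or_one t with h | h
    · exact ⟨0, by omega, by simp only [h, ht]; simp⟩
    · exact ⟨1, by omega, by simp only [h, ht]; simp⟩
  · exact ⟨4, by omega, by simp⟩
  · intro t ht
    have := hf1 t ht
    have h3 : f t = 0 ∨ f t = 1 := by omega
    by_cases c2 : (t = 0 ∨ (t % 2 = 0 ∧ t ≠ m ∧ f t = 0) ∨ (t % 2 = 1 ∧ m ≤ t ∧ f t = 1))
    · exact ⟨2, by omega, by simp only [c2, ht]; simp⟩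
    by_cases c3 : ((t % 2 = 0 ∧ m ≤ t ∧ f t = 1) ∨ (t % 2 = 1 ∧ f t = 0))
    · exact ⟨3, by omega, by simp only [c3, ht]; simp⟩
    have c4 : ((0 < t ∧ t < m ∧ f t = 1) ∨ (t = m ∧ f t = 0)) := by omega
    exact ⟨4, by omega, by simp only [c4, ht]; simp⟩
  · intro t ht h
    rcases Nat.mod_two_eq_zero_or_one t with h' | h'
    · exact ⟨2, by omega, by simp only [h, h', ht]; simp⟩
    · exact ⟨3, by omega, by simp only [h, h', ht]; simp⟩
  · intro t t' r r' c h1 h2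
    have F1 := hf1 t
    have F2 := hf2 t
    have F3 := hf1 r
    have F4 := hf2 r
    have F5 := hf2 (t + m)
    have F6 := hf2 (r + m)
    have F7 : t + m = r → f (t + m) = f r := fun e => by rw [e]
    have F8 : r + m = t → f (r + m) = f t := fun e => by rw [e]
    have F9 : t = r → f t = f r := fun e => by rw [e]
    rcases h1 with h | h | h | h | h | h | h | h <;> rcases h2 with g | g | g | g | g | g | g | g <;>
    first
    | (exfalso; omega)
    | (obtain ⟨-, rfl, h, h'⟩ := h
       obtain ⟨-, rfl, g, g'⟩ := g
       first
       | exact mgood_sum (H.lt _ (by omega)) (H.lt _ h) (H.lt _ (by omega)) (H.lt _ g) (H.k0 _ h h') (H.k0 _ g g')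
       | exact mgood_sum (H.lt _ (by omega)) (H.lt _ h) (H.lt _ (by omega)) (H.lt _ g) (H.k1 _ h h') (H.k1 _ g g'))
    | (obtain ⟨-, h0, h, rfl, h'⟩ := h
       obtain ⟨-, g0, g, rfl, g'⟩ := g
       first
       | exact mgood_sum (H.lt _ (by omega)) (H.lt _ (by omega)) (H.lt _ (by omega)) (H.lt _ (by omega)) (H.c2 _ h0 h h') (H.c2 _ g0 g g')
       | exact mgood_sum (H.lt _ (by omega)) (H.lt _ (by omega)) (H.lt _ (by omega)) (H.lt _ (by omega)) (H.c3 _ h0 h h') (H.c3 _ g0 g g'))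
    | (obtain ⟨-, rfl, rfl⟩ := h
       obtain ⟨-, rfl, rfl⟩ := g
       left; exact ⟨rfl, rfl⟩)
    | (obtain ⟨-, rfl, h, h'⟩ := h
       exact H.good_adj h (by omega) (by omega) (by omega))
    | (obtain ⟨-, rfl, g, g'⟩ := g
       exact H.good_adj' g (by omega) (by omega) (by omega) (by omega))

set_option maxHeartbeats 4000000 in
/-- case I : `n < 2 m` -/
theorem AB.caseI {n m s0 s1 s2 s3 w : ℕ} {p : ℕ → ℕ} (H : AB n m s0 s1 s2 s3 p)
    (h2m : n < 2 * m) (hw1 : 2 ≤ w) (hw2 : w + 2 ≤ n) (hs2 : s2 + 1 = w)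
    (p0 : p 0 = 0) (pw : p (n - 1) = w) (p1 : p (m - 1) + 1 = n) (pv : p (n - 1 - m) + 1 = w)
    (p2 : p (2 * n - 1 - 2 * m) = 2) : ABC n m p := by
  have hn := H.hn
  have hm := H.hm
  have m0 := H.m0
  have mn := H.mn
  obtain ⟨a, ha⟩ : ∃ a, a = 2 * n - 1 - 2 * m := ⟨_, rfl⟩
  rw [← ha] at p2
  have w2 : w ≠ 2 := by
    intro e
    have := H.inj _ (by omega) _ (by omega) (pw.trans (e.trans p2.symm))
    omega
  have w3 : w ≠ 3 := by
    intro e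
    have := H.inj (n - 1 - m) (by omega) a (by omega) (by omega)
    omega
  refine ⟨fun t t' c =>
    (c = 0 ∧ t' = t + 1 ∧ t' < n ∧ t % 2 = 0) ∨
    (c = 1 ∧ t' = t + 1 ∧ t' < n ∧ t % 2 = 1) ∨
    (c = 2 ∧ t = n - 1 ∧ t' = 0) ∨
    (c = 2 ∧ t < n ∧ n ≤ t + m ∧ t' = t + m - n ∧ t % 2 = 0 ∧ t ≠ n - 1) ∨
    (c = 3 ∧ t < n ∧ n ≤ t + m ∧ t' = t + m - n ∧ t % 2 = 1 ∧ t ≠ a) ∨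
    (c = 3 ∧ t' = t + m ∧ t' < n ∧ (t = n - 1 - m ∨ t + m = a)) ∨
    (c = 4 ∧ t = n - 1 ∧ t' = m - 1) ∨
    (c = 4 ∧ t = a ∧ t' = n - 1 - m) ∨
    (c = 4 ∧ t' = t + m ∧ t' < n ∧ t ≠ n - 1 - m ∧ t + m ≠ a),
    ?_, ?_, ?_, ?_, ?_⟩
  · intro t ht
    rcases Nat.mod_two_eq_zero_or_one t with h | h
    · exact ⟨0, by omega, by simp only [h, ht]; simp⟩
    · exact ⟨1, by omega, by simp only [h, ht]; simp⟩
  · exact ⟨2, by omega, by simp⟩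
  · intro t ht
    by_cases c3 : (t = n - 1 - m ∨ t + m = a)
    · exact ⟨3, by omega, by simp only [c3, ht]; simp⟩
    · refine ⟨4, by omega, ?_⟩
      simp only [ht]
      push Not at c3
      simp [c3]
  · intro t ht h
    rcases Nat.mod_two_eq_zero_or_one t with h' | h'
    · by_cases e : t = n - 1
      · exact ⟨4, by omega, by simp; omega⟩
      · exact ⟨2, by omega, by simp only [h, h', ht]; simp [e]⟩
    · by_cases e : t = a
      · exact ⟨4, by omega, by simp; omega⟩
      · exact ⟨3, by omega, by simp only [h, h', ht]; simp [e]⟩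
  · have spec : ∀ r, r < n → n ≤ r + m → r % 2 = 0 → r ≠ n - 1 →
        MGood (p (n - 1)) (p 0) (p r) (p (r + m - n)) := by
      intro r h1 h2 h3 h4
      have q1 : p r ≠ 0 := fun e => absurd (H.inj r h1 0 (by omega) (by omega)) (by omega)
      have q2 : p r ≠ w := fun e => absurd (H.inj r h1 (n - 1) (by omega) (by omega)) (by omega)
      have q3 : p (r + m - n) ≠ 0 :=
        fun e => absurd (H.inj (r + m - n) (by omega) 0 (by omega) (by omega)) (by omega)
      have q4 : p (r + m - n) ≠ w :=
        fun e => absurd (H.inj (r + m - n) (by omega) (n - 1) (by omega) (by omega)) (by omega)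
      have l1 := H.lt r h1
      have l2 := H.lt (r + m - n) (by omega)
      rw [pw, p0]
      apply mgood_nat
      rcases H.c2 r h1 h2 h3 with h | h <;> omega
    have pne : ∀ t r, t < n → r < n → t ≠ r → p t ≠ p r := fun t r ht hr h e => h (H.inj t ht r hr e)
    intro t t' r r' c h1 h2
    rcases h1 with h | h | h | h | h | h | h | h | h <;>
      rcases h2 with g | g | g | g | g | g | g | g | g <;>
    first
    | (exfalso; omega)
    | (obtain ⟨-, rfl, h, h'⟩ := h
       obtain ⟨-, rfl, g, g'⟩ := g
       first
       | exact mgood_sum (H.lt _ (by omega)) (H.lt _ h) (H.lt _ (by omega)) (H.lt _ g) (H.k0 _ h h') (H.k0 _ g g')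
       | exact mgood_sum (H.lt _ (by omega)) (H.lt _ h) (H.lt _ (by omega)) (H.lt _ g) (H.k1 _ h h') (H.k1 _ g g'))
    | (obtain ⟨-, h0, h, rfl, h', -⟩ := h
       obtain ⟨-, g0, g, rfl, g', -⟩ := g
       first
       | exact mgood_sum (H.lt _ (by omega)) (H.lt _ (by omega)) (H.lt _ (by omega)) (H.lt _ (by omega)) (H.c2 _ h0 h h') (H.c2 _ g0 g g')
       | exact mgood_sum (H.lt _ (by omega)) (H.lt _ (by omega)) (H.lt _ (by omega)) (H.lt _ (by omega)) (H.c3 _ h0 h h') (H.c3 _ g0 g g'))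
    | (obtain ⟨-, ht, ht'⟩ := h
       obtain ⟨-, hr, hr'⟩ := g
       subst t t' r r'
       left; exact ⟨rfl, rfl⟩)
    | (obtain ⟨-, ht, ht'⟩ := h
       obtain ⟨-, hr, hr'⟩ := g
       subst t t' r r'
       apply mgood_nat
       omega)
    | (obtain ⟨-, h, h'⟩ := h
       obtain ⟨-, g0, g, hr', g', g''⟩ := g
       subst t t' r'
       exact spec r g0 g g' g'')
    | (obtain ⟨-, e1, e2⟩ := g
       obtain ⟨-, g0, g, hr', g', g''⟩ := h
       subst t' r r'
       exact MGood.symm (pne _ _ (by omega) (by omega) (by omega))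
         (pne _ _ (by omega) (by omega) (by omega)) (spec t g0 g g' g''))
    | (obtain ⟨-, rfl, h, h'⟩ := h
       exact H.good_adj h (by omega) (by omega) (by omega))
    | (obtain ⟨-, rfl, g, g'⟩ := g
       exact H.good_adj' g (by omega) (by omega) (by omega) (by omega))

theorem val_sum {n : ℕ} [NeZero n] {a b S : ZMod n} (h : a + b = S) :
    a.val + b.val = S.val ∨ a.val + b.val = S.val + n := by
  have h1 := ZMod.val_add a b
  rw [h] at h1
  have ha := ZMod.val_lt a
  have hb := ZMod.val_lt b
  by_cases hc : a.val + b.val < n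
  · rw [Nat.mod_eq_of_lt hc] at h1
    omega
  · rw [Nat.mod_eq_sub_mod (by omega), Nat.mod_eq_of_lt (by omega)] at h1
    omega

theorem val_add_nat {n : ℕ} [NeZero n] (a : ZMod n) {s : ℕ} (hs : s < n) :
    (a + s).val = a.val + s ∨ (a + s).val + n = a.val + s := by
  have := val_sum (a := a) (b := (s : ZMod n)) rfl
  rw [ZMod.val_natCast_of_lt hs] at this
  omega

theorem cadj_of {n : ℕ} [NeZero n] (hn : 2 ≤ n) {a b : ZMod n} (h : b = a + 1) :
    Cadj n a.val b.val := by
  have := val_add_nat a (s := 1) (by omega)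
  rw [Nat.cast_one, ← h] at this
  have ha := ZMod.val_lt a
  have hb := ZMod.val_lt b
  unfold Cadj
  omega

theorem Cadj.symm {n a b : ℕ} (h : Cadj n a b) : Cadj n b a := by
  unfold Cadj at *
  omega

def pAB (n : ℕ) (K : ZMod n) (t : ℕ) : ℕ :=
  (if t % 2 = 0 then (t : ZMod n) * K else -((t : ZMod n) + 1) * K : ZMod n).val

theorem pAB_even {n : ℕ} (K : ZMod n) {t : ℕ} (h : t % 2 = 0) :
    pAB n K t = ((t : ZMod n) * K).val := by
  unfold pAB; rw [if_pos h]

theorem pAB_odd {n : ℕ} (K : ZMod n) {t : ℕ} (h : t % 2 = 1) :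
    pAB n K t = (-((t : ZMod n) + 1) * K).val := by
  unfold pAB; rw [if_neg (by omega)]

theorem AB_of {n m : ℕ} [NeZero n] (K : ZMod n) (hn : 5 ≤ n) (ho : n % 2 = 1) (hm : m % 2 = 0)
    (mn : m < n) (hK : (m : ZMod n) * K = 1) :
    AB n m (-2 * K).val 0 (-1 - K).val (1 - K).val (pAB n K) := by
  have m0 : 0 < m := by
    rcases Nat.eq_zero_or_pos m with h | h
    · exfalso
      subst h
      have := natCast_ne_zero' n 1 (by omega) (by omega)
      push_cast at this hK
      rw [zero_mul] at hK
      exact this hK.symm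
    · exact h
  have canc : ∀ x y : ZMod n, x * K = y * K → x = y := by
    intro x y h
    have : x * (m * K) = y * (m * K) := by linear_combination (m : ZMod n) * h
    simpa [hK] using this
  have castn : ∀ t, n ≤ t + m → ((t + m - n : ℕ) : ZMod n) = t + m := by
    intro t h
    rw [Nat.cast_sub h]
    simp
  constructor
  · exact ho
  · exact hm
  · exact m0
  · exact mn
  · intro t _
    exact ZMod.val_lt _
  · intro t ht r hr h
    have inj := ZMod.val_injective n
    have cast_inj : ∀ a b : ℕ, a < n → b < n → (a : ZMod n) = b → a = b := by
      intro a b ha hb h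
      have := congrArg ZMod.val h
      rwa [ZMod.val_natCast_of_lt ha, ZMod.val_natCast_of_lt hb] at this
    have mixed : ∀ a b : ℕ, a < n → b < n → a % 2 = 0 → b % 2 = 1 →
        (a : ZMod n) * K ≠ -((b : ZMod n) + 1) * K := by
      intro a b ha hb h1 h2 h
      have h := canc _ _ h
      have : ((a + b + 1 : ℕ) : ZMod n) = 0 := by
        push_cast
        rw [h]; ring
      rw [ZMod.natCast_eq_zero_iff] at this
      obtain ⟨q, hq⟩ := this
      have : q < 2 := by
        by_contra hh
        have : n * 2 ≤ n * q := Nat.mul_le_mul_left n (by omega)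
        omega
      interval_cases q <;> omega
    rcases Nat.mod_two_eq_zero_or_one t with h1 | h1 <;>
      rcases Nat.mod_two_eq_zero_or_one r with h2 | h2
    · rw [pAB_even K h1, pAB_even K h2] at h
      exact cast_inj _ _ ht hr (canc _ _ (inj h))
    · rw [pAB_even K h1, pAB_odd K h2] at h
      exact absurd (inj h) (mixed _ _ ht hr h1 h2)
    · rw [pAB_odd K h1, pAB_even K h2] at h
      exact absurd (inj h).symm (mixed _ _ hr ht h2 h1)
    · rw [pAB_odd K h1, pAB_odd K h2] at h
      have := canc _ _ (inj h)
      refine cast_inj _ _ ht hr ?_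
      linear_combination -this
  · intro t ht h
    rw [pAB_even K h, pAB_odd K (by omega)]
    apply val_sum
    push_cast
    ring
  · intro t ht h
    rw [pAB_odd K h, pAB_even K (by omega)]
    have := val_sum (a := -((t : ZMod n) + 1) * K) (b := ((t + 1 : ℕ) : ZMod n) * K) (S := 0)
      (by push_cast; ring)
    rwa [ZMod.val_zero] at this
  · intro t ht h h'
    rw [pAB_even K h', pAB_odd K (by omega)]
    apply val_sum
    rw [castn t h]
    linear_combination -hK
  · intro t ht h h'
    rw [pAB_odd K h', pAB_even K (by omega)]
    apply val_sum
    rw [castn t h]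
    linear_combination hK
  · intro t ht
    rcases Nat.mod_two_eq_zero_or_one t with h1 | h1
    · rw [pAB_even K h1, pAB_even K (by omega)]
      apply cadj_of (by omega)
      push_cast
      linear_combination hK
    · rw [pAB_odd K h1, pAB_odd K (by omega)]
      apply Cadj.symm
      apply cadj_of (by omega)
      push_cast
      linear_combination hK

theorem ABC_of {n m : ℕ} [NeZero n] (K : ZMod n) (hn : 5 ≤ n) (ho : n % 2 = 1) (hm : m % 2 = 0)
    (mn : m < n) (hK : (m : ZMod n) * K = 1) (K1 : K ≠ 1) (K2 : K ≠ -1) :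
    ABC n m (pAB n K) := by
  have H := AB_of K hn ho hm mn hK
  rcases lt_or_ge (2 * m) n with h | h
  · exact H.caseII h
  have K0 : K ≠ 0 := by
    rintro rfl
    have := natCast_ne_zero' n 1 (by omega) (by omega)
    push_cast at this hK
    rw [mul_zero] at hK
    exact this hK.symm
  have m0 := H.m0
  have wl := ZMod.val_lt (-K)
  have v1 : (1 : ZMod n).val = 1 := by
    have := ZMod.val_natCast_of_lt (n := n) (a := 1) (by omega)
    simpa using this
  have w0 : (-K).val ≠ 0 := by
    rw [Ne, ZMod.val_eq_zero]
    simpa using K0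
  have w1 : (-K).val ≠ 1 := by
    intro h
    rw [← v1] at h
    have := ZMod.val_injective n h
    exact K2 (by rw [← this]; simp)
  have wm : (-1 - K).val + 1 = (-K).val := by
    have := val_add_nat (-1 - K) (s := 1) (by omega)
    have e : -1 - K + ((1 : ℕ) : ZMod n) = -K := by push_cast; ring
    rw [e] at this
    have := ZMod.val_lt (-1 - K)
    omega
  have vm1 : (-1 : ZMod n).val + 1 = n := by
    have := val_add_nat (-1 : ZMod n) (s := 1) (by omega)
    have e : -1 + ((1 : ℕ) : ZMod n) = 0 := by push_cast; ring
    rw [e, ZMod.val_zero] at this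
    omega
  have wn : (-K).val + 1 ≠ n := by
    intro h
    have : (-K).val = (-1 : ZMod n).val := by omega
    have := ZMod.val_injective n this
    exact K1 (by simpa using this)
  have cn : ((n - 1 : ℕ) : ZMod n) = -1 := by
    rw [Nat.cast_sub (by omega)]; simp
  have cm : ((m - 1 : ℕ) : ZMod n) = m - 1 := by
    rw [Nat.cast_sub (by omega)]; simp
  have cnm : ((n - 1 - m : ℕ) : ZMod n) = -1 - m := by
    rw [Nat.cast_sub (by omega), cn]
  have c2 : ((2 * n - 1 - 2 * m : ℕ) : ZMod n) = -1 - 2 * m := by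
    rw [Nat.cast_sub (by omega), Nat.cast_sub (by omega)]
    push_cast
    simp
  refine H.caseI (w := (-K).val) (by omega) (by omega) (by omega) wm ?_ ?_ ?_ ?_ ?_
  · rw [pAB_even K rfl]; simp
  · rw [pAB_even K (by omega), cn]; simp
  · rw [pAB_odd K (by omega), cm]
    rw [show -((m : ZMod n) - 1 + 1) * K = -1 by linear_combination -hK]
    exact vm1
  · rw [pAB_even K (by omega), cnm]
    rw [show (-1 - (m : ZMod n)) * K = -1 - K by linear_combination -hK]
    exact wm
  · rw [pAB_odd K (by omega), c2]
    rw [show -(-1 - 2 * (m : ZMod n) + 1) * K = (2 : ℕ) by push_cast; linear_combination 2 * hK]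
    exact ZMod.val_natCast_of_lt (by omega)

theorem hasMBE_AB {n m k : ℕ} [NeZero n] (K : ZMod n) (hKk : (k : ZMod n) = K ∨ (k : ZMod n) = -K)
    (hn : 5 ≤ n) (ho : n % 2 = 1) (hm : m % 2 = 0)
    (mn : m < n) (hK : (m : ZMod n) * K = 1) (K1 : K ≠ 1) (K2 : K ≠ -1) :
    HasMBE (circ n k) 5 := by
  have H := AB_of K hn ho hm mn hK
  obtain ⟨E, e1, e2, e3, e4, e5⟩ := ABC_of K hn ho hm mn hK K1 K2
  let T : ZMod n → ℕ := fun v => (v * m).val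
  have hT : ∀ v, T v < n := fun v => ZMod.val_lt _
  have Tinj : Function.Injective T := by
    intro a b h
    have h := ZMod.val_injective n h
    have : a * (m * K) = b * (m * K) := by linear_combination K * h
    simpa [hK] using this
  have one : ∀ u v : ZMod n, v = u + 1 → ∃ c < 5, E (T u) (T v) c := by
    intro u v h
    have : T v = T u + m ∨ T v + n = T u + m := by
      have := val_add_nat (u * (m : ZMod n)) mn
      rw [show u * (m : ZMod n) + (m : ZMod n) = v * (m : ZMod n) by rw [h]; ring] at this
      exact this
    have := hT v
    have := hT u
    by_cases hc : T u + m < n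
    · rw [show T v = T u + m by omega]
      exact e3 _ hc
    · rw [show T v = T u + m - n by omega]
      exact e4 _ (hT u) (by omega)
  have two : ∀ u v : ZMod n, v = u + K → ∃ c < 5, E (T u) (T v) c := by
    intro u v h
    have : T v = T u + 1 ∨ T v + n = T u + 1 := by
      have := val_add_nat (u * (m : ZMod n)) (s := 1) (by omega)
      rw [show u * (m : ZMod n) + ((1 : ℕ) : ZMod n) = v * (m : ZMod n) by
        rw [h]; push_cast; linear_combination -hK] at this
      exact this
    have := hT v
    have := hT u
    by_cases hc : T u + 1 < n
    · rw [show T v = T u + 1 by omega]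
      exact e1 _ hc
    · rw [show T v = 0 by omega, show T u = n - 1 by omega]
      exact e2
  refine hasMBE_of (circ n k) 5 (by omega) (fun v => pAB n K (T v)) ?_
    (fun u v c => E (T u) (T v) c) ?_ ?_
  · intro a b h
    exact Tinj (H.inj _ (hT _) _ (hT _) h)
  · have fin : ∀ u v, (∃ c < 5, E (T u) (T v) c) →
        ∃ c < 5, E (T u) (T v) c ∨ E (T v) (T u) c := fun u v ⟨c, h, h'⟩ => ⟨c, h, Or.inl h'⟩
    have fin' : ∀ u v, (∃ c < 5, E (T v) (T u) c) →
        ∃ c < 5, E (T u) (T v) c ∨ E (T v) (T u) c := fun u v ⟨c, h, h'⟩ => ⟨c, h, Or.inr h'⟩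
    intro u v h
    rw [circ_adj] at h
    obtain ⟨_, h | h | h | h⟩ := h
    · exact fin _ _ (one _ _ h)
    · rcases hKk with e | e <;> rw [e] at h
      · exact fin _ _ (two _ _ h)
      · exact fin' _ _ (two _ _ (by rw [h]; ring))
    · exact fin' _ _ (one _ _ h)
    · rcases hKk with e | e <;> rw [e] at h
      · exact fin' _ _ (two _ _ h)
      · exact fin _ _ (two _ _ (by rw [h]; ring))
  · intro u v u' v' c
    exact e5 _ _ _ _ _

theorem scheme2 (n k : ℕ) (hn : 5 ≤ n) (hk : 2 ≤ k) (hk' : k ≤ n / 2) (ho : n % 2 = 1)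
    (hc : Nat.Coprime k n) : HasMBE (circ n k) 5 := by
  have : NeZero n := ⟨by omega⟩
  have h1 := ZMod.coe_mul_inv_eq_one k hc
  set u := ((k : ZMod n)⁻¹).val with hu
  have hul : u < n := ZMod.val_lt _
  have h2 : (u : ZMod n) * k = 1 := by
    rw [hu, ZMod.natCast_zmod_val, mul_comm]; exact h1
  have kne : (k : ZMod n) ≠ 1 := by
    have := natCast_ne_zero' n (k - 1) (by omega) (by omega)
    intro h
    apply this
    rw [Nat.cast_sub (by omega), h]; simp
  have kne' : (k : ZMod n) ≠ -1 := by
    have := natCast_ne_zero' n (k + 1) (by omega) (by omega)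
    intro h
    apply this
    push_cast
    rw [h]; simp
  rcases Nat.mod_two_eq_zero_or_one u with h | h
  · exact hasMBE_AB (m := u) (k : ZMod n) (Or.inl rfl) hn ho h hul h2 kne kne'
  · refine hasMBE_AB (m := n - u) (-(k : ZMod n)) (Or.inr (by simp)) hn ho (by omega) (by omega)
      ?_ (fun h => kne' (by rw [← h]; simp)) (fun h => kne (by simpa using h))
    rw [Nat.cast_sub hul.le]
    simp [h2]

theorem scheme1 (n k : ℕ) (hn : 5 ≤ n) (hk : 2 ≤ k) (hk' : k ≤ n / 2) (ho : n % 2 = 0)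
    (hc : k % 2 = 1) : HasMBE (circ n k) (Dg n k) := by
  have : NeZero n := ⟨by omega⟩
  let P : ℕ → ℕ := fun a => if a % 2 = 0 then a else if a = 1 then 1 else n + 2 - a
  have Pev : ∀ a, a % 2 = 0 → P a = a := fun a h => if_pos h
  have Pod : ∀ a, a % 2 = 1 → a < n → (P a + a = n + 2 ∨ P a + a = 2) ∧ P a < n ∧ P a % 2 = 1 := by
    intro a h ha
    simp only [P]
    rw [if_neg (by omega)]
    split_ifs <;> omega
  have vl : ∀ v : ZMod n, v.val < n := fun v => ZMod.val_lt v
  let E0 : ℕ → ℕ → ℕ → Prop := fun a b c => a < n ∧ b < n ∧ a % 2 = 0 ∧ b % 2 = 1 ∧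
    ((c = 0 ∧ (b = a + 1 ∨ b + n = a + 1)) ∨ (c = 1 ∧ (a = b + 1 ∨ a + n = b + 1)) ∨
     (c = 2 ∧ (b = a + k ∨ b + n = a + k)) ∨
     (c = 3 ∧ n ≠ 2 * k ∧ (a = b + k ∨ a + n = b + k)))
  have hD : Dg n k = 3 ∧ n = 2 * k ∨ Dg n k = 4 ∧ n ≠ 2 * k := by
    unfold Dg; split_ifs with h <;> simp [h]
  have ste1 : ∀ a b, a < n → b < n → (b = a + 1 ∨ b + n = a + 1) →
      ∃ c < Dg n k, E0 a b c ∨ E0 b a c := by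
    intro a b ha hb h
    rcases Nat.mod_two_eq_zero_or_one a with h1 | h1
    · exact ⟨0, by omega, Or.inl ⟨ha, hb, h1, by omega, Or.inl ⟨rfl, h⟩⟩⟩
    · exact ⟨1, by omega, Or.inr ⟨hb, ha, by omega, by omega, Or.inr (Or.inl ⟨rfl, h⟩)⟩⟩
  have stek : ∀ a b, a < n → b < n → (b = a + k ∨ b + n = a + k) →
      ∃ c < Dg n k, E0 a b c ∨ E0 b a c := by
    intro a b ha hb h
    rcases Nat.mod_two_eq_zero_or_one a with h1 | h1
    · exact ⟨2, by omega, Or.inl ⟨ha, hb, h1, by omega, Or.inr (Or.inr (Or.inl ⟨rfl, h⟩))⟩⟩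
    · rcases hD with hD | hD
      · exact ⟨2, by omega, Or.inr ⟨hb, ha, by omega, by omega,
          Or.inr (Or.inr (Or.inl ⟨rfl, by omega⟩))⟩⟩
      · exact ⟨3, by omega, Or.inr ⟨hb, ha, by omega, by omega,
          Or.inr (Or.inr (Or.inr ⟨rfl, hD.2, h⟩))⟩⟩
  refine hasMBE_of (circ n k) (Dg n k) (by omega) (fun v => P v.val) ?_
    (fun u v c => E0 u.val v.val c) ?_ ?_
  · intro a b h
    apply ZMod.val_injective n
    have h : P a.val = P b.val := h
    have := vl a
    have := vl b
    have := Pev a.val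
    have := Pev b.val
    have := Pod a.val
    have := Pod b.val
    omega
  · have fin' : ∀ a b, (∃ c < Dg n k, E0 a b c ∨ E0 b a c) → (∃ c < Dg n k, E0 b a c ∨ E0 a b c) :=
      fun a b ⟨c, h, h'⟩ => ⟨c, h, h'.symm⟩
    intro u v h
    rw [circ_adj] at h
    obtain ⟨_, h | h | h | h⟩ := h
    · have := val_add_nat u (s := 1) (by omega)
      rw [Nat.cast_one, ← h] at this
      exact ste1 _ _ (vl _) (vl _) this
    · have := val_add_nat u (s := k) (by omega)
      rw [← h] at this
      exact stek _ _ (vl _) (vl _) this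
    · have := val_add_nat v (s := 1) (by omega)
      rw [Nat.cast_one, ← h] at this
      exact fin' _ _ (ste1 _ _ (vl _) (vl _) this)
    · have := val_add_nat v (s := k) (by omega)
      rw [← h] at this
      exact fin' _ _ (stek _ _ (vl _) (vl _) this)
  · have sums : ∀ a b c, E0 a b c → P a < n ∧ P b < n ∧ c < 4 ∧
        (c = 0 → P a + P b = 1 ∨ P a + P b = 1 + n) ∧
        (c = 1 → P a + P b = 3 ∨ P a + P b = 3 + n) ∧
        (c = 2 → P a + P b = n + 2 - k ∨ P a + P b = n + 2 - k + n ∨ P a + P b + n = n + 2 - k) ∧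
        (c = 3 → P a + P b = k + 2 ∨ P a + P b = k + 2 + n ∨ P a + P b + n = k + 2) := by
      rintro a b c ⟨ha, hb, h1, h2, h⟩
      have := Pev a h1
      obtain ⟨h3 | h3, h4, h5⟩ := Pod b h2 hb <;> omega
    intro u v u' v' c h h'
    obtain ⟨l1, l2, hc4, s0, s1, s2, s3⟩ := sums _ _ _ h
    obtain ⟨l1', l2', -, s0', s1', s2', s3'⟩ := sums _ _ _ h'
    interval_cases c
    · exact mgood_sum l1 l2 l1' l2' (s0 rfl) (s0' rfl)
    · exact mgood_sum l1 l2 l1' l2' (s1 rfl) (s1' rfl)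
    · have a1 := s2 rfl
      have a2 := s2' rfl
      clear s0 s1 s2 s3 s0' s1' s2' s3'
      rcases le_or_gt 2 k with hh | hh
      · have : k = 2 ∨ 2 < k := by omega
        exact mgood_sum (s := n + 2 - k) l1 l2 l1' l2' (by omega) (by omega)
      · omega
    · have a1 := s3 rfl
      have a2 := s3' rfl
      exact mgood_sum (s := k + 2) l1 l2 l1' l2' (by omega) (by omega)

/-- lexicographic order on pairs, unbundled -/
def LL (r p s q : ℕ) : Prop := r < s ∨ (r = s ∧ p < q)

/-- two chords, given by their sorted endpoints, are compatible -/
def SG (r p r' p' s q s' q' : ℕ) : Prop :=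
  LL r p r' p' ∧ LL s q s' q' ∧
  (LL r' p' s q ∨ LL s' q' r p ∨ (LL r p s q ∧ LL s' q' r' p') ∨ (LL s q r p ∧ LL r' p' s' q') ∨
    (r = s ∧ p = q ∧ r' = s' ∧ p' = q'))

def TorusGood (d L Y m : ℕ) : Prop :=
  ∃ (R P : ℕ → ℕ → ℕ) (E : ℕ → ℕ → ℕ → ℕ → ℕ → Prop),
    (∀ c x c' x', c < d → x < L → c' < d → x' < L → R c x = R c' x' → P c x = P c' x' →
      c = c' ∧ x = x') ∧
    (∀ c x, c < d → x + 1 < L → ∃ e < m, E (R c x) (P c x) (R c (x + 1)) (P c (x + 1)) e ∨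
      E (R c (x + 1)) (P c (x + 1)) (R c x) (P c x) e) ∧
    (∀ c, c < d → ∃ e < m, E (R c (L - 1)) (P c (L - 1)) (R c 0) (P c 0) e ∨
      E (R c 0) (P c 0) (R c (L - 1)) (P c (L - 1)) e) ∧
    (∀ c x, c + 1 < d → x < L → ∃ e < m, E (R c x) (P c x) (R (c + 1) x) (P (c + 1) x) e ∨
      E (R (c + 1) x) (P (c + 1) x) (R c x) (P c x) e) ∧
    (∀ x, x + Y < L → ∃ e < m,
      E (R 0 x) (P 0 x) (R (d - 1) (x + Y)) (P (d - 1) (x + Y)) e ∨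
      E (R (d - 1) (x + Y)) (P (d - 1) (x + Y)) (R 0 x) (P 0 x) e) ∧
    (∀ x, x < L → L ≤ x + Y → ∃ e < m,
      E (R 0 x) (P 0 x) (R (d - 1) (x + Y - L)) (P (d - 1) (x + Y - L)) e ∨
      E (R (d - 1) (x + Y - L)) (P (d - 1) (x + Y - L)) (R 0 x) (P 0 x) e) ∧
    (∀ r p r' p' s q s' q' e, E r p r' p' e → E s q s' q' e → SG r p r' p' s q s' q')

theorem LL_iff (r p s q : ℕ) : LL r p s q ↔ toLex (r, p) < toLex (s, q) := by
  rw [Prod.Lex.toLex_lt_toLex]; rfl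

theorem SG.mgood {r p r' p' s q s' q' : ℕ} (h : SG r p r' p' s q s' q') :
    MGood (toLex (r, p)) (toLex (r', p')) (toLex (s, q)) (toLex (s', q')) := by
  unfold SG at h
  simp only [LL_iff] at h
  obtain ⟨h1, h2, h⟩ := h
  unfold MGood Xor
  rw [min_eq_left h1.le, max_eq_right h1.le]
  rcases h with h | h | h | h | ⟨rfl, rfl, rfl, rfl⟩
  · right; right
    refine ⟨(h1.trans h).ne, (h1.trans (h.trans h2)).ne, h.ne, (h.trans h2).ne, ?_⟩
    rintro (⟨h3, _⟩ | ⟨h3, _⟩)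
    · exact lt_asymm h3.2 h
    · exact lt_asymm h3.2 (h.trans h2)
  · right; right
    refine ⟨(h2.trans h).ne', h.ne', (h2.trans (h.trans h1)).ne', (h.trans h1).ne', ?_⟩
    rintro (⟨h3, _⟩ | ⟨h3, _⟩)
    · exact lt_asymm h3.1 (h2.trans h)
    · exact lt_asymm h3.1 h
  · right; right
    refine ⟨h.1.ne, (h.1.trans h2).ne, (h2.trans h.2).ne', h.2.ne', ?_⟩
    rintro (⟨_, h3⟩ | ⟨_, h3⟩)
    · exact h3 ⟨h.1.trans h2, h.2⟩
    · exact h3 ⟨h.1, h2.trans h.2⟩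
  · right; right
    refine ⟨h.1.ne', (h1.trans h.2).ne, (h.1.trans h1).ne', h.2.ne, ?_⟩
    rintro (⟨h3, _⟩ | ⟨h3, _⟩)
    · exact lt_asymm h3.1 h.1
    · exact lt_asymm h3.2 h.2
  · left; exact ⟨rfl, rfl⟩

theorem torus_hasMBE {n k d L Y m : ℕ} [NeZero n] (K : ZMod n)
    (hKk : (k : ZMod n) = K ∨ (k : ZMod n) = -K) (hm : 0 < m) (hL : 2 ≤ L) (hd : 1 ≤ d)
    (hex : ∀ v : ZMod n, ∃ c x : ℕ, c < d ∧ x < L ∧ v = c + x * K)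
    (huq : ∀ c x c' x' : ℕ, c < d → x < L → c' < d → x' < L →
      (c : ZMod n) + x * K = c' + x' * K → c = c' ∧ x = x')
    (hLK : (L : ZMod n) * K = 0) (hY : (d : ZMod n) + Y * K = 0) (hYL : Y < L)
    (H : TorusGood d L Y m) : HasMBE (circ n k) m := by
  obtain ⟨R, P, E, inj, eH, eC, eV, eW1, eW2, good⟩ := H
  choose C X hC hX hv using hex
  have uq : ∀ (v : ZMod n) (c x : ℕ), c < d → x < L → v = c + x * K → C v = c ∧ X v = x := by
    intro v c x hc hx h
    exact huq _ _ _ _ (hC v) (hX v) hc hx ((hv v).symm.trans h)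
  let E' : ZMod n → ZMod n → ℕ → Prop := fun u v e =>
    E (R (C u) (X u)) (P (C u) (X u)) (R (C v) (X v)) (P (C v) (X v)) e
  have one : ∀ u v : ZMod n, v = u + 1 → ∃ e < m, E' u v e ∨ E' v u e := by
    intro u v h
    have hu := hv u
    have a1 := hC u
    have a2 := hX u
    simp only [E']
    by_cases h1 : C u + 1 < d
    · obtain ⟨q1, q2⟩ := uq v (C u + 1) (X u) h1 a2 (by
        rw [h]; nth_rewrite 1 [hu]; push_cast; ring)
      rw [q1, q2]
      exact eV _ _ h1 a2
    · have e1 : C u = d - 1 := by omega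
      have e2 : ((C u : ℕ) : ZMod n) + 1 = d := by
        rw [e1, Nat.cast_sub hd]; simp
      by_cases h2 : Y ≤ X u
      · obtain ⟨q1, q2⟩ := uq v 0 (X u - Y) (by omega) (by omega) (by
          rw [h, Nat.cast_sub h2]; nth_rewrite 1 [hu]; push_cast
          linear_combination e2 + hY)
        have := eW1 (X u - Y) (by omega)
        rw [Nat.sub_add_cancel h2] at this
        rw [q1, q2, e1]
        obtain ⟨e, he, h⟩ := this
        exact ⟨e, he, h.symm⟩
      · obtain ⟨q1, q2⟩ := uq v 0 (X u + L - Y) (by omega) (by omega) (by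
          rw [h, Nat.cast_sub (by omega)]; nth_rewrite 1 [hu]; push_cast
          linear_combination e2 + hY - hLK)
        have := eW2 (X u + L - Y) (by omega) (by omega)
        rw [show X u + L - Y + Y - L = X u by omega] at this
        rw [q1, q2, e1]
        obtain ⟨e, he, h⟩ := this
        exact ⟨e, he, h.symm⟩
  have two : ∀ u v : ZMod n, v = u + K → ∃ e < m, E' u v e ∨ E' v u e := by
    intro u v h
    have hu := hv u
    have a1 := hC u
    have a2 := hX u
    simp only [E']
    by_cases h1 : X u + 1 < L
    · obtain ⟨q1, q2⟩ := uq v (C u) (X u + 1) a1 h1 (by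
        rw [h]; nth_rewrite 1 [hu]; push_cast; ring)
      rw [q1, q2]
      exact eH _ _ a1 h1
    · have e1 : X u = L - 1 := by omega
      have e2 : ((X u : ℕ) : ZMod n) + 1 = L := by
        rw [e1, Nat.cast_sub (by omega)]; simp
      obtain ⟨q1, q2⟩ := uq v (C u) 0 a1 (by omega) (by
        rw [h]; nth_rewrite 1 [hu]; push_cast
        linear_combination K * e2 + hLK)
      rw [q1, q2, e1]
      exact eC _ a1
  refine hasMBE_of (circ n k) m hm (fun v => toLex (R (C v) (X v), P (C v) (X v))) ?_ E' ?_ ?_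
  · intro u v h
    have h : toLex (R (C u) (X u), P (C u) (X u)) = toLex (R (C v) (X v), P (C v) (X v)) := h
    rw [EmbeddingLike.apply_eq_iff_eq, Prod.mk.injEq] at h
    obtain ⟨h1, h2⟩ := inj _ _ _ _ (hC u) (hX u) (hC v) (hX v) h.1 h.2
    rw [hv u, hv v, h1, h2]
  · have fin : ∀ u v, (∃ e < m, E' v u e ∨ E' u v e) → (∃ e < m, E' u v e ∨ E' v u e) :=
      fun u v ⟨c, h, h'⟩ => ⟨c, h, h'.symm⟩
    intro u v h
    rw [circ_adj] at h
    obtain ⟨_, h | h | h | h⟩ := h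
    · exact one _ _ h
    · rcases hKk with e | e <;> rw [e] at h
      · exact two _ _ h
      · exact fin _ _ (two _ _ (by rw [h]; ring))
    · exact fin _ _ (one _ _ h)
    · rcases hKk with e | e <;> rw [e] at h
      · exact fin _ _ (two _ _ h)
      · exact two _ _ (by rw [h]; ring)
  · intro u v u' v' c h h'
    exact (good _ _ _ _ _ _ _ _ _ h h').mgood

theorem torus_main (n k d L : ℕ) (hd : d = Nat.gcd n k) (hL : n = d * L) (h2 : 2 ≤ L) (hn : 0 < n) :
    ∃ Y, 0 < Y ∧ Y < L ∧ ((d : ZMod n) + Y * k = 0) ∧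
      (∀ m, 0 < m → TorusGood d L Y m → HasMBE (circ n k) m) ∧
      (∀ m, 0 < m → TorusGood d L (L - Y) m → HasMBE (circ n k) m) := by
  have : NeZero n := ⟨by omega⟩
  have hd1 : 1 ≤ d := by
    rcases Nat.eq_zero_or_pos d with h | h
    · subst h; omega
    · exact h
  obtain ⟨κ, hκ⟩ : d ∣ k := hd ▸ Nat.gcd_dvd_right n k
  have hcop : Nat.Coprime L κ := by
    have h := Nat.coprime_div_gcd_div_gcd (m := n) (n := k) (by rw [← hd]; omega)
    rw [← hd] at h
    rw [hL, hκ] at h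
    rwa [Nat.mul_div_cancel_left _ hd1, Nat.mul_div_cancel_left _ hd1] at h
  have uq : ∀ (K : ZMod n), ((k : ZMod n) = K ∨ (k : ZMod n) = -K) →
      ∀ c x c' x' : ℕ, c < d → x < L → c' < d → x' < L →
      (c : ZMod n) + x * K = c' + x' * K → c = c' ∧ x = x' := by
    intro K hK c x c' x' hc hx hc' hx' h
    obtain ⟨σ, hσ, hσK⟩ : ∃ σ : ℤ, (σ = 1 ∨ σ = -1) ∧ K = ((σ * k : ℤ) : ZMod n) := by
      rcases hK with e | e
      · exact ⟨1, Or.inl rfl, by push_cast; rw [e]; ring⟩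
      · exact ⟨-1, Or.inr rfl, by push_cast; rw [e]; ring⟩
    have h1 : (((c : ℤ) + x * (σ * k) : ℤ) : ZMod n) = (((c' : ℤ) + x' * (σ * k) : ℤ) : ZMod n) := by
      rw [hσK] at h
      push_cast at h ⊢
      exact h
    rw [ZMod.intCast_eq_intCast_iff_dvd_sub] at h1
    obtain ⟨z, hz⟩ := h1
    have hz' : (c' : ℤ) - c = d * (L * z - (x' - x) * σ * κ) := by
      rw [hL, hκ] at hz
      push_cast at hz
      linear_combination hz
    have e1 : c = c' := by
      have hdv : (d : ℤ) ∣ (c' : ℤ) - c := ⟨_, hz'⟩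
      have := Int.eq_zero_of_abs_lt_dvd hdv (by rw [abs_lt]; constructor <;> omega)
      omega
    refine ⟨e1, ?_⟩
    subst e1
    have hz2 : (L : ℤ) * z - (x' - x) * σ * κ = 0 := by
      rw [sub_self] at hz'
      rcases mul_eq_zero.mp hz'.symm with h | h
      · omega
      · exact h
    have hdv : (L : ℤ) ∣ ((x' : ℤ) - x) * κ := by
      rcases hσ with rfl | rfl
      · exact ⟨z, by linear_combination -hz2⟩
      · exact ⟨-z, by linear_combination hz2⟩
    have hdv2 : (L : ℤ) ∣ ((x' : ℤ) - x) :=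
      IsCoprime.dvd_of_dvd_mul_right (Nat.isCoprime_iff_coprime.mpr hcop) hdv
    have := Int.eq_zero_of_abs_lt_dvd hdv2 (by rw [abs_lt]; constructor <;> omega)
    omega
  have ex : ∀ (K : ZMod n), ((k : ZMod n) = K ∨ (k : ZMod n) = -K) →
      ∀ v : ZMod n, ∃ c x : ℕ, c < d ∧ x < L ∧ v = c + x * K := by
    intro K hK
    let φ : Fin d × Fin L → ZMod n := fun q => (q.1 : ℕ) + (q.2 : ℕ) * K
    have hφ : Function.Bijective φ := by
      rw [Fintype.bijective_iff_injective_and_card]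
      constructor
      · rintro ⟨c, x⟩ ⟨c', x'⟩ h
        obtain ⟨h1, h2⟩ := uq K hK c x c' x' c.2 x.2 c'.2 x'.2 h
        rw [Prod.mk.injEq]
        exact ⟨Fin.ext h1, Fin.ext h2⟩
      · rw [Fintype.card_prod, Fintype.card_fin, Fintype.card_fin, ZMod.card, ← hL]
    intro v
    obtain ⟨⟨c, x⟩, h⟩ := hφ.2 v
    exact ⟨c, x, c.2, x.2, h.symm⟩
  have hLK : (L : ZMod n) * k = 0 := by
    have : ((L * k : ℕ) : ZMod n) = 0 := by
      rw [ZMod.natCast_eq_zero_iff]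
      exact ⟨κ, by rw [hL, hκ]; ring⟩
    push_cast at this
    exact this
  obtain ⟨c, Y, hc, hYL, hcY⟩ := ex (k : ZMod n) (Or.inl rfl) (-(d : ZMod n))
  have hc0 : c = 0 := by
    have : ((d + c + Y * k : ℕ) : ZMod n) = 0 := by
      push_cast
      linear_combination -hcY
    rw [ZMod.natCast_eq_zero_iff] at this
    have h3 : d ∣ d + c + Y * k := Dvd.dvd.trans ⟨L, hL⟩ this
    have h4 : d ∣ Y * k := Dvd.dvd.mul_left ⟨κ, hκ⟩ Y
    have h5 : d ∣ d + c := (Nat.dvd_add_left h4).mp h3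
    have h6 : d ∣ c := (Nat.dvd_add_right (dvd_refl d)).mp h5
    exact Nat.eq_zero_of_dvd_of_lt h6 hc
  have hY : (d : ZMod n) + Y * k = 0 := by
    rw [hc0] at hcY
    push_cast at hcY
    linear_combination -hcY
  have hY0 : 0 < Y := by
    rcases Nat.eq_zero_or_pos Y with h | h
    · exfalso
      subst h
      have := natCast_ne_zero' n d hd1 (by nlinarith)
      apply this
      simpa using hY
    · exact h
  refine ⟨Y, hY0, hYL, hY, ?_, ?_⟩
  · intro m hm
    exact torus_hasMBE (k : ZMod n) (Or.inl rfl) hm h2 hd1 (ex _ (Or.inl rfl)) (uq _ (Or.inl rfl))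
      hLK hY hYL
  · intro m hm
    have q : (k : ZMod n) = - -(k : ZMod n) := by simp
    refine torus_hasMBE (-(k : ZMod n)) (Or.inr q) hm h2 hd1 (ex _ (Or.inr q)) (uq _ (Or.inr q))
      (by rw [mul_neg, hLK, neg_zero]) ?_ (by omega)
    rw [Nat.cast_sub hYL.le]
    linear_combination hY - hLK

set_option maxHeartbeats 4000000 in
theorem torus3 (d L Y : ℕ) (hd : d % 2 = 0) (hd0 : 0 < d) (hL : 3 ≤ L) (hY : 0 < Y)
    (hYL : 2 * Y ≤ L) : TorusGood d L Y 5 := by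
  let P : ℕ → ℕ → ℕ := fun c x => if c % 2 = 0 then x else L - 1 - x
  have Pe : ∀ c x, c % 2 = 0 → P c x = x := fun c x h => if_pos h
  have Po : ∀ c x, c % 2 = 1 → P c x = L - 1 - x := fun c x h => if_neg (by omega)
  let E : ℕ → ℕ → ℕ → ℕ → ℕ → Prop := fun r p r' p' e =>
    (e = 0 ∧ r' = r + 1 ∧ p + p' + 1 = L ∧ r % 2 = 0 ∧ r + 1 < d) ∨
    (e = 1 ∧ r' = r + 1 ∧ p + p' + 1 = L ∧ r % 2 = 1 ∧ r + 1 < d) ∨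
    (e = 1 ∧ r = 0 ∧ r' = d - 1 ∧ p + p' + 1 + Y = L) ∨
    (e = 2 ∧ r = 0 ∧ r' = d - 1 ∧ p + p' + 1 + Y = 2 * L ∧ p < L ∧ p' < L) ∨
    (e = 2 ∧ r' = r ∧ p' = p + 1 ∧ p + 1 < L ∧ r < d ∧
      ((r ≠ 0 ∧ r + 1 ≠ d ∧ p % 2 = 0) ∨ ((r = 0 ∨ r + 1 = d) ∧ p + 2 + Y ≤ L ∧ (L - p - Y) % 2 = 0))) ∨
    (e = 3 ∧ r' = r ∧ p' = p + 1 ∧ p + 1 < L ∧ r < d ∧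
      ((r ≠ 0 ∧ r + 1 ≠ d ∧ p % 2 = 1) ∨ ((r = 0 ∨ r + 1 = d) ∧
        ((p + 2 + Y ≤ L ∧ (L - p - Y) % 2 = 1) ∨ (L < p + 2 + Y ∧ (L - p) % 2 = 0))))) ∨
    (e = 4 ∧ r' = r ∧ p' = p + 1 ∧ p + 1 < L ∧ r < d ∧
      ((r = 0 ∨ r + 1 = d) ∧ L < p + 2 + Y ∧ (L - p) % 2 = 1)) ∨
    (e = 4 ∧ r' = r ∧ p = 0 ∧ p' + 1 = L ∧ r < d)
  have row : ∀ c p, c < d → p + 1 < L → ∃ e < 5, E c p c (p + 1) e := by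
    intro c p hc hp
    have hr : (r' : ℕ) → (r' = 2 ∨ r' = 3 ∨ r' = 4) → r' < 5 := by omega
    by_cases h2 : ((c ≠ 0 ∧ c + 1 ≠ d ∧ p % 2 = 0) ∨ ((c = 0 ∨ c + 1 = d) ∧ p + 2 + Y ≤ L ∧ (L - p - Y) % 2 = 0))
    · exact ⟨2, by omega, Or.inr (Or.inr (Or.inr (Or.inr (Or.inl ⟨rfl, rfl, rfl, hp, hc, h2⟩))))⟩
    by_cases h3 : ((c ≠ 0 ∧ c + 1 ≠ d ∧ p % 2 = 1) ∨ ((c = 0 ∨ c + 1 = d) ∧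
        ((p + 2 + Y ≤ L ∧ (L - p - Y) % 2 = 1) ∨ (L < p + 2 + Y ∧ (L - p) % 2 = 0))))
    · exact ⟨3, by omega,
        Or.inr (Or.inr (Or.inr (Or.inr (Or.inr (Or.inl ⟨rfl, rfl, rfl, hp, hc, h3⟩)))))⟩
    · exact ⟨4, by omega, Or.inr (Or.inr (Or.inr (Or.inr (Or.inr (Or.inr
        (Or.inl ⟨rfl, rfl, rfl, hp, hc, by omega⟩))))))⟩
  have clo : ∀ c, c < d → ∃ e < 5, E c 0 c (L - 1) e := by
    intro c hc
    exact ⟨4, by omega, Or.inr (Or.inr (Or.inr (Or.inr (Or.inr (Or.inr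
        (Or.inr ⟨rfl, rfl, rfl, by omega, hc⟩))))))⟩
  refine ⟨fun c _ => c, P, E, ?_, ?_, ?_, ?_, ?_, ?_, ?_⟩
  · intro c x c' x' hc hx hc' hx' h1 h2
    subst h1
    rcases Nat.mod_two_eq_zero_or_one c with h | h
    · rw [Pe _ _ h, Pe _ _ h] at h2; exact ⟨rfl, h2⟩
    · rw [Po _ _ h, Po _ _ h] at h2; exact ⟨rfl, by omega⟩
  · intro c x hc hx
    rcases Nat.mod_two_eq_zero_or_one c with h | h
    · rw [Pe _ _ h, Pe _ _ h]
      obtain ⟨e, he, h⟩ := row c x hc hx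
      exact ⟨e, he, Or.inl h⟩
    · rw [Po _ _ h, Po _ _ h]
      obtain ⟨e, he, h⟩ := row c (L - 1 - (x + 1)) hc (by omega)
      rw [show L - 1 - (x + 1) + 1 = L - 1 - x by omega] at h
      exact ⟨e, he, Or.inr h⟩
  · intro c hc
    obtain ⟨e, he, h'⟩ := clo c hc
    rcases Nat.mod_two_eq_zero_or_one c with h | h
    · rw [Pe _ _ h, Pe _ _ h]
      exact ⟨e, he, Or.inr h'⟩
    · rw [Po _ _ h, Po _ _ h, Nat.sub_self, Nat.sub_zero]
      exact ⟨e, he, Or.inl h'⟩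
  · intro c x hc hx
    rcases Nat.mod_two_eq_zero_or_one c with h | h
    · rw [Pe _ _ h, Po _ _ (by omega)]
      exact ⟨0, by omega, Or.inl (Or.inl ⟨rfl, rfl, by omega, h, hc⟩)⟩
    · rw [Po _ _ h, Pe _ _ (by omega)]
      exact ⟨1, by omega, Or.inl (Or.inr (Or.inl ⟨rfl, rfl, by omega, h, hc⟩))⟩
  · intro x hx
    rw [Pe _ _ rfl, Po _ _ (by omega)]
    exact ⟨1, by omega, Or.inl (Or.inr (Or.inr (Or.inl ⟨rfl, rfl, rfl, by omega⟩)))⟩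
  · intro x hx hx'
    rw [Pe _ _ rfl, Po _ _ (by omega)]
    exact ⟨2, by omega, Or.inl (Or.inr (Or.inr (Or.inr (Or.inl
      ⟨rfl, rfl, rfl, by omega, by omega, by omega⟩))))⟩
  · intro r p r' p' s q s' q' e h1 h2
    clear row clo Pe Po
    rcases h1 with h | h | h | h | h | h | h | h <;> rcases h2 with g | g | g | g | g | g | g | g <;>
    first
    | exact absurd (h.1.symm.trans g.1) (by decide)
    | (obtain ⟨-, h⟩ := h
       obtain ⟨-, g⟩ := g
       refine ⟨?_, ?_, ?_⟩
       · unfold LL; omega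
       · unfold LL; omega
       · unfold LL; omega)

theorem torus3b (d : ℕ) (hd : d % 2 = 0) (hd0 : 0 < d) : TorusGood d 2 1 4 := by
  let P : ℕ → ℕ → ℕ := fun c x => if c % 2 = 0 then x else 1 - x
  have Pe : ∀ c x, c % 2 = 0 → P c x = x := fun c x h => if_pos h
  have Po : ∀ c x, c % 2 = 1 → P c x = 1 - x := fun c x h => if_neg (by omega)
  let E : ℕ → ℕ → ℕ → ℕ → ℕ → Prop := fun r p r' p' e =>
    (e = 0 ∧ r' = r + 1 ∧ p + p' = 1 ∧ r % 2 = 0 ∧ r + 1 < d) ∨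
    (e = 1 ∧ r' = r + 1 ∧ p + p' = 1 ∧ r % 2 = 1 ∧ r + 1 < d) ∨
    (e = 1 ∧ r = 0 ∧ r' = d - 1 ∧ p = 0 ∧ p' = 0) ∨
    (e = 2 ∧ r = 0 ∧ r' = d - 1 ∧ p = 1 ∧ p' = 1) ∨
    (e = 3 ∧ r' = r ∧ p = 0 ∧ p' = 1)
  have row : ∀ c, E c 0 c 1 3 := by
    intro c
    exact Or.inr (Or.inr (Or.inr (Or.inr ⟨rfl, rfl, rfl, rfl⟩)))
  refine ⟨fun c _ => c, P, E, ?_, ?_, ?_, ?_, ?_, ?_, ?_⟩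
  · intro c x c' x' hc hx hc' hx' h1 h2
    subst h1
    rcases Nat.mod_two_eq_zero_or_one c with h | h
    · rw [Pe _ _ h, Pe _ _ h] at h2; exact ⟨rfl, h2⟩
    · rw [Po _ _ h, Po _ _ h] at h2; exact ⟨rfl, by omega⟩
  · intro c x hc hx
    obtain rfl : x = 0 := by omega
    rcases Nat.mod_two_eq_zero_or_one c with h | h
    · rw [Pe _ _ h, Pe _ _ h]
      exact ⟨3, by omega, Or.inl (row c)⟩
    · rw [Po _ _ h, Po _ _ h]
      exact ⟨3, by omega, Or.inr (row c)⟩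
  · intro c hc
    rcases Nat.mod_two_eq_zero_or_one c with h | h
    · rw [Pe _ _ h, Pe _ _ h]
      exact ⟨3, by omega, Or.inr (row c)⟩
    · rw [Po _ _ h, Po _ _ h]
      exact ⟨3, by omega, Or.inl (row c)⟩
  · intro c x hc hx
    rcases Nat.mod_two_eq_zero_or_one c with h | h
    · rw [Pe _ _ h, Po _ _ (by omega)]
      exact ⟨0, by omega, Or.inl (Or.inl ⟨rfl, rfl, by omega, h, hc⟩)⟩
    · rw [Po _ _ h, Pe _ _ (by omega)]
      exact ⟨1, by omega, Or.inl (Or.inr (Or.inl ⟨rfl, rfl, by omega, h, hc⟩))⟩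
  · intro x hx
    rw [Pe _ _ rfl, Po _ _ (by omega)]
    exact ⟨1, by omega, Or.inl (Or.inr (Or.inr (Or.inl ⟨rfl, rfl, rfl, by omega, by omega⟩)))⟩
  · intro x hx hx'
    rw [Pe _ _ rfl, Po _ _ (by omega)]
    exact ⟨2, by omega, Or.inl (Or.inr (Or.inr (Or.inr (Or.inl
      ⟨rfl, rfl, rfl, by omega, by omega⟩))))⟩
  · intro r p r' p' s q s' q' e h1 h2
    clear row Pe Po
    rcases h1 with h | h | h | h | h <;> rcases h2 with g | g | g | g | g <;>
    first
    | exact absurd (h.1.symm.trans g.1) (by decide)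
    | (obtain ⟨-, h⟩ := h
       obtain ⟨-, g⟩ := g
       refine ⟨?_, ?_, ?_⟩
       · unfold LL; omega
       · unfold LL; omega
       · unfold LL; omega)

/-- coloured chords of the layout used for `torus5` -/
inductive E5 (d L r p r' p' : ℕ) : ℕ → Prop
  | v0 (h : r' = r ∧ p' = p + 1 ∧ p + 1 < d ∧ 1 ≤ r ∧ r + 2 ≤ L ∧ p % 2 = 0) : E5 d L r p r' p' 0
  | v1 (h : r' = r ∧ p' = p + 1 ∧ p + 1 < d ∧ 1 ≤ r ∧ r + 2 ≤ L ∧ p % 2 = 1) : E5 d L r p r' p' 1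
  | m0 (h : r = 0 ∧ r' = 0 ∧ p' < 2 * d ∧ p % 4 = 1 ∧ p' = p + 1) : E5 d L r p r' p' 0
  | m0' (h : r = 0 ∧ r' = 0 ∧ p' < 2 * d ∧ p % 4 = 0 ∧ p' = p + 3) : E5 d L r p r' p' 0
  | m1 (h : r = 0 ∧ r' = 0 ∧ p' < 2 * d ∧ p % 4 = 3 ∧ p' = p + 1) : E5 d L r p r' p' 1
  | m1' (h : r = 0 ∧ r' = 0 ∧ p' < 2 * d ∧ p % 4 = 2 ∧ p' = p + 3) : E5 d L r p r' p' 1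
  | w0 (h : r = 0 ∧ p + 1 = 2 * d ∧ r' = 1 ∧ p' + 1 = d) : E5 d L r p r' p' 0
  | w0' (h : 1 ≤ r ∧ r' = r + 1 ∧ r + 3 ≤ L ∧ r % 2 = 0 ∧ p' + 1 = d ∧ p + 1 = d) :
      E5 d L r p r' p' 0
  | w1 (h : r = 0 ∧ p = 0 ∧ r' + 2 = L ∧ p' = 0) : E5 d L r p r' p' 1
  | w1' (h : 1 ≤ r ∧ r' = r + 1 ∧ r + 3 ≤ L ∧ r % 2 = 1 ∧ p' = 0 ∧ p = 0) :
      E5 d L r p r' p' 1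
  | x2 (h : r = 0 ∧ r' = 0 ∧ p = 1 ∧ p' + 2 = 2 * d) : E5 d L r p r' p' 2
  | h3 (h : r = 0 ∧ r' = 1 ∧ p' < d ∧ 1 ≤ p' ∧
      ((p' % 2 = 0 ∧ p + 2 * p' = 2 * d - 1) ∨ (p' % 2 = 1 ∧ p + 2 * p' = 2 * d - 2))) :
      E5 d L r p r' p' 3
  | h2 (h : r = 0 ∧ r' = 1 ∧ p' = 0 ∧ p + 1 = 2 * d) : E5 d L r p r' p' 2
  | g3 (h : 1 ≤ r ∧ r' = r + 1 ∧ r + 3 ≤ L ∧ r % 2 = 0 ∧ p + p' + 1 = d) : E5 d L r p r' p' 3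
  | g4 (h : 1 ≤ r ∧ r' = r + 1 ∧ r + 3 ≤ L ∧ r % 2 = 1 ∧ p + p' + 1 = d) : E5 d L r p r' p' 4
  | k4 (h : r = 0 ∧ r' + 2 = L ∧ p' + 1 < d ∧
      ((p' % 2 = 0 ∧ p + 2 * p' = 2 * d - 2) ∨ (p' % 2 = 1 ∧ p + 2 * p' = 2 * d - 1))) :
      E5 d L r p r' p' 4
  | k2 (h : r = 0 ∧ p = 0 ∧ r' + 2 = L ∧ p' + 1 = d) : E5 d L r p r' p' 2
  | c2 (h : r = 0 ∧ r' = 0 ∧ p' = p + 1 ∧ p % 2 = 0 ∧ 2 ≤ p ∧ p + 4 ≤ 2 * d) :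
      E5 d L r p r' p' 2
  | c3 (h : r = 0 ∧ r' = 0 ∧ p + 2 = 2 * d ∧ p' = p + 1) : E5 d L r p r' p' 3
  | c4 (h : r = 0 ∧ r' = 0 ∧ p = 0 ∧ p' = 1) : E5 d L r p r' p' 4

set_option maxHeartbeats 4000000 in
theorem E5_good (d L : ℕ) (hd : d % 2 = 1) (hd3 : 3 ≤ d) (hL : L % 2 = 1) (hL3 : 3 ≤ L)
    (r p r' p' s q s' q' e : ℕ) (h1 : E5 d L r p r' p' e) (h2 : E5 d L s q s' q' e) :
    SG r p r' p' s q s' q' := by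
  cases h1 <;> cases h2 <;>
  · rename_i h g
    refine ⟨?_, ?_, ?_⟩
    · unfold LL; omega
    · unfold LL; omega
    · unfold LL; omega

set_option maxHeartbeats 4000000 in
theorem torus5 (d L : ℕ) (hd : d % 2 = 1) (hd3 : 3 ≤ d) (hL : L % 2 = 1) (hL3 : 3 ≤ L) :
    TorusGood d L (L - 1) 5 := by
  let R : ℕ → ℕ → ℕ := fun c x => if x = 0 ∨ x + 1 = L then 0 else x
  let P : ℕ → ℕ → ℕ := fun c x => if x = 0 then (if c % 2 = 0 then 2 * c + 1 else 2 * c) else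
    if x + 1 = L then (if c % 2 = 0 then 2 * c else 2 * c + 1) else
    if x % 2 = 0 then c else d - 1 - c
  refine ⟨R, P, E5 d L, ?_, ?_, ?_, ?_, ?_, ?_, fun r p r' p' s q s' q' e =>
    E5_good d L hd hd3 hL hL3 r p r' p' s q s' q' e⟩
  · intro c x c' x' hc hx hc' hx' h1 h2
    simp only [R, P] at h1 h2
    split_ifs at h1 h2 <;> omega
  · intro c x hc hx
    by_cases x0 : x = 0
    · simp only [R, P]
      by_cases hc1 : c + 1 = d
      · exact ⟨2, by omega, Or.inl (.h2 (by split_ifs <;> first | contradiction | omega | (simp only [false_or, not_false_eq_true] at *; omega)))⟩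
      · exact ⟨3, by omega, Or.inl (.h3 (by split_ifs <;> first | contradiction | omega | (simp only [false_or, not_false_eq_true] at *; omega)))⟩
    by_cases x1 : x + 2 = L
    · simp only [R, P]
      by_cases hc1 : c = 0
      · exact ⟨2, by omega, Or.inr (.k2 (by split_ifs <;> first | contradiction | omega | (simp only [false_or, not_false_eq_true] at *; omega)))⟩
      · exact ⟨4, by omega, Or.inr (.k4 (by split_ifs <;> first | contradiction | omega | (simp only [false_or, not_false_eq_true] at *; omega)))⟩
    · simp only [R, P]
      by_cases hc1 : x % 2 = 0
      · exact ⟨3, by omega, Or.inl (.g3 (by split_ifs <;> first | contradiction | omega | (simp only [false_or, not_false_eq_true] at *; omega)))⟩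
      · exact ⟨4, by omega, Or.inl (.g4 (by split_ifs <;> first | contradiction | omega | (simp only [false_or, not_false_eq_true] at *; omega)))⟩
  · intro c hc
    simp only [R, P]
    by_cases c0 : c = 0
    · exact ⟨4, by omega, Or.inl (.c4 (by split_ifs <;> first | contradiction | omega | (simp only [false_or, not_false_eq_true] at *; omega)))⟩
    by_cases c1 : c + 1 = d
    · exact ⟨3, by omega, Or.inl (.c3 (by split_ifs <;> first | contradiction | omega | (simp only [false_or, not_false_eq_true] at *; omega)))⟩
    rcases Nat.mod_two_eq_zero_or_one c with h | h
    · exact ⟨2, by omega, Or.inl (.c2 (by split_ifs <;> first | contradiction | omega | (simp only [false_or, not_false_eq_true] at *; omega)))⟩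
    · exact ⟨2, by omega, Or.inr (.c2 (by split_ifs <;> first | contradiction | omega | (simp only [false_or, not_false_eq_true] at *; omega)))⟩
  · intro c x hc hx
    simp only [R, P]
    by_cases x0 : x = 0
    · rcases Nat.mod_two_eq_zero_or_one c with h | h
      · exact ⟨0, by omega, Or.inl (.m0 (by split_ifs <;> first | contradiction | omega | (simp only [false_or, not_false_eq_true] at *; omega)))⟩
      · exact ⟨1, by omega, Or.inl (.m1' (by split_ifs <;> first | contradiction | omega | (simp only [false_or, not_false_eq_true] at *; omega)))⟩
    by_cases x1 : x + 1 = L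
    · rcases Nat.mod_two_eq_zero_or_one c with h | h
      · exact ⟨0, by omega, Or.inl (.m0' (by split_ifs <;> first | contradiction | omega | (simp only [false_or, not_false_eq_true] at *; omega)))⟩
      · exact ⟨1, by omega, Or.inl (.m1 (by split_ifs <;> first | contradiction | omega | (simp only [false_or, not_false_eq_true] at *; omega)))⟩
    rcases Nat.mod_two_eq_zero_or_one x with h | h <;>
    rcases Nat.mod_two_eq_zero_or_one c with h' | h'
    · exact ⟨0, by omega, Or.inl (.v0 (by split_ifs <;> first | contradiction | omega | (simp only [false_or, not_false_eq_true] at *; omega)))⟩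
    · exact ⟨1, by omega, Or.inl (.v1 (by split_ifs <;> first | contradiction | omega | (simp only [false_or, not_false_eq_true] at *; omega)))⟩
    · exact ⟨1, by omega, Or.inr (.v1 (by split_ifs <;> first | contradiction | omega | (simp only [false_or, not_false_eq_true] at *; omega)))⟩
    · exact ⟨0, by omega, Or.inr (.v0 (by split_ifs <;> first | contradiction | omega | (simp only [false_or, not_false_eq_true] at *; omega)))⟩
  · intro x hx
    obtain rfl : x = 0 := by omega
    simp only [R, P]
    exact ⟨2, by omega, Or.inl (.x2 (by split_ifs <;> first | contradiction | omega | (simp only [false_or, not_false_eq_true] at *; omega)))⟩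
  · intro x hx hx'
    obtain ⟨y, rfl⟩ : ∃ y, x = y + 1 := ⟨x - 1, by omega⟩
    rw [show y + 1 + (L - 1) - L = y by omega]
    simp only [R, P]
    by_cases x0 : y = 0
    · exact ⟨0, by omega, Or.inr (.w0 (by split_ifs <;> first | contradiction | omega | (simp only [false_or, not_false_eq_true] at *; omega)))⟩
    by_cases x1 : y + 2 = L
    · exact ⟨1, by omega, Or.inl (.w1 (by split_ifs <;> first | contradiction | omega | (simp only [false_or, not_false_eq_true] at *; omega)))⟩
    rcases Nat.mod_two_eq_zero_or_one y with h | h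
    · exact ⟨0, by omega, Or.inr (.w0' (by split_ifs <;> first | contradiction | omega | (simp only [false_or, not_false_eq_true] at *; omega)))⟩
    · exact ⟨1, by omega, Or.inr (.w1' (by split_ifs <;> first | contradiction | omega | (simp only [false_or, not_false_eq_true] at *; omega)))⟩

/-- coloured chords of the layout used for `torus4` -/
inductive E4 (d L Y r p r' p' : ℕ) : ℕ → Prop
  | a0 (h : r % 2 = 1 ∧ r' = r + 1 ∧ r + 3 ≤ d ∧ p + p' + 1 = L) : E4 d L Y r p r' p' 0
  | b0 (h : r = 0 ∧ p + 1 = 2 * L ∧ r' + 2 = d ∧ p' + Y = L) : E4 d L Y r p r' p' 0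
  | c0 (h : r = 0 ∧ p = 2 ∧ r' = 0 ∧ p' = 3) : E4 d L Y r p r' p' 0
  | d0 (h : r = 0 ∧ r' = 0 ∧ p % 4 = 0 ∧ 4 ≤ p ∧ p' = p + 3 ∧ p' < 2 * L) : E4 d L Y r p r' p' 0
  | e0 (h : r = 0 ∧ r' = 0 ∧ p = 0 ∧ p' + 2 = 2 * L) : E4 d L Y r p r' p' 0
  | f0 (h : r = 0 ∧ r' = 0 ∧ p % 4 = 1 ∧ 5 ≤ p ∧ p' = p + 1 ∧ p' < 2 * L) : E4 d L Y r p r' p' 0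
  | g0 (h : r + 2 = d ∧ r' = r ∧ p' = p + 1 ∧ p' < L ∧
      ((L < p + Y ∧ p % 2 = 1) ∨ (0 < p ∧ p + Y < L ∧ (p + 1 + Y) % 2 = 0))) : E4 d L Y r p r' p' 0
  | a1 (h : r = 0 ∧ p = 0 ∧ r' = 1 ∧ p' + 1 = L ∧ 5 ≤ d) : E4 d L Y r p r' p' 1
  | b1 (h : r % 2 = 0 ∧ 2 ≤ r ∧ r + 5 ≤ d ∧ r' = r + 1 ∧ p = 0 ∧ p' + 1 = L) : E4 d L Y r p r' p' 1
  | d1 (h : r = 0 ∧ r' = 0 ∧ p % 4 = 3 ∧ p' = p + 1 ∧ p' < 2 * L) : E4 d L Y r p r' p' 1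
  | e1 (h : r = 0 ∧ r' = 0 ∧ p = 1 ∧ p' + 1 = 2 * L) : E4 d L Y r p r' p' 1
  | f1 (h : r = 0 ∧ r' = 0 ∧ p % 4 = 2 ∧ p' = p + 3 ∧ p + 8 ≤ 2 * L) : E4 d L Y r p r' p' 1
  | g1 (h : r + 2 = d ∧ r' = r ∧ p' = p + 1 ∧ p' < L ∧
      ((L < p + Y ∧ p % 2 = 0) ∨ (0 < p ∧ p + Y < L ∧ (p + 1 + Y) % 2 = 1))) : E4 d L Y r p r' p' 1
  | h1 (h : r + 2 = d ∧ r' = r ∧ p = 0 ∧ p' + 1 = L) : E4 d L Y r p r' p' 1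
  | i1 (h : 1 ≤ r ∧ r + 3 ≤ d ∧ r' = r ∧ p' = p + 1 ∧ p' < L ∧ (r + p) % 2 = 1) :
      E4 d L Y r p r' p' 1
  | a2 (h : r = 0 ∧ r' = 1 ∧ 2 ≤ p' ∧ p' + 2 ≤ L ∧
      ((p' % 2 = 0 ∧ p + 2 * p' + 2 = 2 * L) ∨ (p' % 2 = 1 ∧ p + 2 * p' + 1 = 2 * L))) :
      E4 d L Y r p r' p' 2
  | b2 (h : r % 2 = 0 ∧ 2 ≤ r ∧ r + 3 ≤ d ∧ r' = r + 1 ∧ p + p' + 1 = L ∧ p + 3 ≤ L ∧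
      (0 < p ∨ r + 3 = d)) : E4 d L Y r p r' p' 2
  | c2 (h : r = 0 ∧ r' = 0 ∧ p % 2 = 0 ∧ p' = p + 1 ∧ p' < 2 * L ∧ (p = 0 ∨ 2 * L ≤ p + 4)) :
      E4 d L Y r p r' p' 2
  | d2 (h : r + 2 = d ∧ r' = r ∧ p = 0 ∧ p' = 1) : E4 d L Y r p r' p' 2
  | a3 (h : d = 3 ∧ r = 0 ∧ p = 0 ∧ r' = 1 ∧ p' + 1 = L) : E4 d L Y r p r' p' 3
  | b3 (h : r = 0 ∧ r' + 2 = d ∧ ((p % 4 = 1 ∧ p + 2 * p' + 2 * Y + 1 = 2 * L) ∨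
      (p % 4 = 2 ∧ p + 2 * p' + 2 * Y + 2 = 2 * L))) : E4 d L Y r p r' p' 3
  | c3 (h : r = 0 ∧ r' = 0 ∧ p % 2 = 0 ∧ p' = p + 1 ∧ 2 * L ≤ p + 2 * Y ∧ p + 6 ≤ 2 * L) :
      E4 d L Y r p r' p' 3
  | d3 (h : r = 0 ∧ r' = 0 ∧ p + 4 = 2 * L ∧ p' = p + 3) : E4 d L Y r p r' p' 3
  | g3 (h : r + 2 = d ∧ r' = r ∧ p' = p + 1 ∧ p + Y = L) : E4 d L Y r p r' p' 3
  | i3 (h : 1 ≤ r ∧ r + 3 ≤ d ∧ r' = r ∧ p = 0 ∧ p' + 1 = L) : E4 d L Y r p r' p' 3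
  | j3 (h : 1 ≤ r ∧ r + 3 ≤ d ∧ r' = r ∧ p' = p + 1 ∧
      ((r % 2 = 0 ∧ p + 3 = L) ∨ (r % 2 = 1 ∧ p = 1))) : E4 d L Y r p r' p' 3
  | a4 (h : r = 0 ∧ r' = 1 ∧ ((p + 2 = 2 * L ∧ p' = 0) ∨ (p + 3 = 2 * L ∧ p' = 1))) :
      E4 d L Y r p r' p' 4
  | b4 (h : r % 2 = 0 ∧ 2 ≤ r ∧ r + 3 ≤ d ∧ r' = r + 1 ∧ p + p' + 1 = L ∧ L ≤ p + 2) :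
      E4 d L Y r p r' p' 4
  | c4 (h : r = 0 ∧ r' + 2 = d ∧ p + 3 ≤ 2 * L ∧ p' < L ∧
      ((p % 4 = 1 ∧ p + 2 * p' + 2 * Y + 1 = 4 * L) ∨
      (p % 4 = 2 ∧ p + 2 * p' + 2 * Y + 2 = 4 * L))) : E4 d L Y r p r' p' 4
  | e4 (h : r = 0 ∧ r' = 0 ∧ p % 2 = 0 ∧ p' = p + 1 ∧ 4 ≤ p ∧ p + 2 * Y < 2 * L) :
      E4 d L Y r p r' p' 4
  | f4 (h : r = 0 ∧ r' = 0 ∧ p = 0 ∧ p' = 3) : E4 d L Y r p r' p' 4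
  | g4 (h : r = 0 ∧ r' = 0 ∧ p = 1 ∧ p' = 2) : E4 d L Y r p r' p' 4
  | i4 (h : 1 ≤ r ∧ r + 3 ≤ d ∧ r' = r ∧ p' = p + 1 ∧
      ((r % 2 = 0 ∧ p % 2 = 0 ∧ p + 5 ≤ L) ∨ (r % 2 = 1 ∧ p % 2 = 1 ∧ 3 ≤ p ∧ p + 2 ≤ L))) :
      E4 d L Y r p r' p' 4

set_option maxHeartbeats 16000000 in
theorem E4_good (d L Y : ℕ) (hd : d % 2 = 1) (hd3 : 3 ≤ d) (hL : L % 2 = 1) (hY : 3 ≤ Y)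
    (hYL : Y + 2 ≤ L)
    (r p r' p' s q s' q' e : ℕ) (h1 : E4 d L Y r p r' p' e) (h2 : E4 d L Y s q s' q' e) :
    SG r p r' p' s q s' q' := by
  cases h1 <;> cases h2 <;>
  · rename_i h g
    refine ⟨?_, ?_, ?_⟩
    · unfold LL; omega
    · unfold LL; omega
    · unfold LL; omega

set_option maxHeartbeats 16000000 in
theorem torus4 (d L Y : ℕ) (hd : d % 2 = 1) (hd3 : 3 ≤ d) (hL : L % 2 = 1) (hY : 3 ≤ Y)
    (hYL : Y + 2 ≤ L) : TorusGood d L Y 5 := by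
  -- positions of `(0, j)` and of its partner in the block
  let A : ℕ → ℕ := fun j => if j % 2 = 0 then 2 * j else 2 * j + 1
  let Z : ℕ → ℕ := fun j => if j % 2 = 0 then 2 * j + 1 else 2 * j
  let J : ℕ → ℕ := fun x => if Y ≤ x then x - Y else x + L - Y
  let R : ℕ → ℕ → ℕ := fun c x => if c + 1 = d then 0 else c
  let P : ℕ → ℕ → ℕ := fun c x => if c = 0 then A x else if c + 1 = d then Z (J x) else
    if c % 2 = 0 then x else L - 1 - x
  have hA : ∀ j, (j % 2 = 0 ∧ A j = 2 * j) ∨ (j % 2 = 1 ∧ A j = 2 * j + 1) := by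
    intro j; simp only [A]; split_ifs <;> omega
  have hZ : ∀ j, (j % 2 = 0 ∧ Z j = 2 * j + 1) ∨ (j % 2 = 1 ∧ Z j = 2 * j) := by
    intro j; simp only [Z]; split_ifs <;> omega
  have hJ : ∀ x, (Y ≤ x ∧ J x + Y = x) ∨ (x < Y ∧ J x + Y = x + L) := by
    intro j; simp only [J]; split_ifs <;> omega
  have R0 : ∀ x, R 0 x = 0 := fun x => by simp [R]
  have Rd : ∀ x, R (d - 1) x = 0 := fun x => if_pos (by omega)
  have Rm : ∀ c x, c + 1 < d → R c x = c := fun c x h => if_neg (by omega)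
  have P0 : ∀ x, P 0 x = A x := fun x => if_pos rfl
  have Pd : ∀ x, P (d - 1) x = Z (J x) := fun x => by
    simp only [P]; rw [if_neg (by omega), if_pos (by omega)]
  have Pm : ∀ c x, 0 < c → c + 1 < d →
      (c % 2 = 0 ∧ P c x = x) ∨ (c % 2 = 1 ∧ P c x = L - 1 - x) := by
    intro c x h h'
    simp only [P]; rw [if_neg (by omega), if_neg (by omega)]; split_ifs <;> omega
  clear_value R P A Z J
  have zz : ∀ j, j + 1 < L → ∃ e < 5, E4 d L Y 0 (Z j) 0 (Z (j + 1)) e := by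
    intro j hj
    have h1 := hZ j
    have h2 := hZ (j + 1)
    by_cases j0 : j = 0
    · exact ⟨4, by omega, .g4 (by omega)⟩
    by_cases j1 : j + 2 = L
    · exact ⟨3, by omega, .d3 (by omega)⟩
    rcases Nat.mod_two_eq_zero_or_one j with h | h
    · exact ⟨0, by omega, .f0 (by omega)⟩
    · exact ⟨1, by omega, .f1 (by omega)⟩
  have zc : E4 d L Y 0 (Z 0) 0 (Z (L - 1)) 1 := by
    have h1 := hZ 0
    have h2 := hZ (L - 1)
    exact .e1 (by omega)
  have rung : ∀ j, j < L → ∃ e < 5, E4 d L Y 0 (A j) 0 (Z j) e ∨ E4 d L Y 0 (Z j) 0 (A j) e := by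
    intro j hj
    have key : ∃ e < 5, E4 d L Y 0 (2 * j) 0 (2 * j + 1) e := by
      by_cases j0 : j = 0 ∨ L ≤ j + 2
      · exact ⟨2, by omega, .c2 (by omega)⟩
      by_cases j1 : j = 1
      · exact ⟨0, by omega, .c0 (by omega)⟩
      by_cases j2 : j + Y < L
      · exact ⟨4, by omega, .e4 (by omega)⟩
      · exact ⟨3, by omega, .c3 (by omega)⟩
    obtain ⟨e, he, h⟩ := key
    have h1 := hA j
    have h2 := hZ j
    rcases Nat.mod_two_eq_zero_or_one j with h' | h'
    · refine ⟨e, he, Or.inl ?_⟩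
      rwa [show A j = 2 * j by omega, show Z j = 2 * j + 1 by omega]
    · refine ⟨e, he, Or.inr ?_⟩
      rwa [show A j = 2 * j + 1 by omega, show Z j = 2 * j by omega]
  refine ⟨R, P, E4 d L Y, ?_, ?_, ?_, ?_, ?_, ?_, fun r p r' p' s q s' q' e =>
    E4_good d L Y hd hd3 hL hY hYL r p r' p' s q s' q' e⟩
  · intro c x c' x' hc hx hc' hx' h1 h2
    have tri : ∀ c, c < d → c = 0 ∨ c = d - 1 ∨ (0 < c ∧ c + 1 < d) := by omega
    have a1 := hA x
    have a2 := hA x'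
    have a3 := hZ (J x)
    have a4 := hZ (J x')
    have a5 := hJ x
    have a6 := hJ x'
    rcases tri c hc with rfl | rfl | ⟨h, h'⟩ <;> rcases tri c' hc' with g | g | ⟨g, g'⟩
    · subst g; rw [P0, P0] at h2; omega
    · subst g; rw [P0, Pd] at h2; omega
    · rw [R0, Rm _ _ g'] at h1; omega
    · subst g; rw [P0, Pd] at h2; omega
    · subst g; rw [Pd, Pd] at h2; omega
    · rw [Rd, Rm _ _ g'] at h1; omega
    · subst g; rw [R0, Rm _ _ h'] at h1; omega
    · subst g; rw [Rd, Rm _ _ h'] at h1; omega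
    · rw [Rm _ _ h', Rm _ _ g'] at h1
      subst h1
      have b1 := Pm c x h h'
      have b2 := Pm c x' h h'
      omega
  · intro c x hc hx
    by_cases c0 : c = 0
    · subst c0
      simp only [R0, P0]
      have h1 := hA x
      have h2 := hA (x + 1)
      by_cases x0 : x = 0
      · subst x0
        have h3 := hA 1
        exact ⟨4, by omega, Or.inl (.f4 (by rw [zero_add]; omega))⟩
      rcases Nat.mod_two_eq_zero_or_one x with h | h
      · exact ⟨0, by omega, Or.inl (.d0 (by omega))⟩
      · exact ⟨1, by omega, Or.inl (.d1 (by omega))⟩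
    by_cases c1 : c = d - 1
    · subst c1
      simp only [Rd, Pd]
      have h1 := hJ x
      have h2 := hJ (x + 1)
      by_cases xY : x + 1 = Y
      · rw [show J x = L - 1 by omega, show J (x + 1) = 0 by omega]
        exact ⟨1, by omega, Or.inr zc⟩
      · rw [show J (x + 1) = J x + 1 by omega]
        obtain ⟨e, he, h⟩ := zz (J x) (by omega)
        exact ⟨e, he, Or.inl h⟩
    have h1 := Pm c x (by omega) (by omega)
    have h2 := Pm c (x + 1) (by omega) (by omega)
    rw [Rm _ _ (by omega), Rm _ _ (by omega)]
    generalize P c x = u at *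
    generalize P c (x + 1) = v at *
    by_cases c2 : c + 2 = d
    · by_cases j0 : x + 2 = L
      · exact ⟨2, by omega, Or.inr (.d2 (by omega))⟩
      by_cases j1 : x + 2 = Y
      · exact ⟨3, by omega, Or.inr (.g3 (by omega))⟩
      by_cases j2 : ((L < v + Y ∧ v % 2 = 1) ∨ (0 < v ∧ v + Y < L ∧ (v + 1 + Y) % 2 = 0))
      · exact ⟨0, by omega, Or.inr (.g0 (by omega))⟩
      · exact ⟨1, by omega, Or.inr (.g1 (by omega))⟩
    · rcases h1 with ⟨hc2, rfl⟩ | ⟨hc2, h1⟩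
      · by_cases j1 : u % 2 = 1
        · exact ⟨1, by omega, Or.inl (.i1 (by omega))⟩
        by_cases j3 : u + 3 = L
        · exact ⟨3, by omega, Or.inl (.j3 (by omega))⟩
        · exact ⟨4, by omega, Or.inl (.i4 (by omega))⟩
      · by_cases j1 : x % 2 = 1
        · exact ⟨1, by omega, Or.inr (.i1 (by omega))⟩
        by_cases j3 : x + 3 = L
        · exact ⟨3, by omega, Or.inr (.j3 (by omega))⟩
        · exact ⟨4, by omega, Or.inr (.i4 (by omega))⟩
  · intro c hc
    by_cases c0 : c = 0
    · subst c0
      simp only [R0, P0]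
      have h1 := hA 0
      have h2 := hA (L - 1)
      exact ⟨0, by omega, Or.inr (.e0 (by omega))⟩
    by_cases c1 : c = d - 1
    · subst c1
      simp only [Rd, Pd]
      have h1 := hJ 0
      have h2 := hJ (L - 1)
      rw [show J 0 = J (L - 1) + 1 by omega]
      obtain ⟨e, he, h⟩ := zz (J (L - 1)) (by omega)
      exact ⟨e, he, Or.inl h⟩
    have h1 := Pm c 0 (by omega) (by omega)
    have h2 := Pm c (L - 1) (by omega) (by omega)
    rw [Rm _ _ (by omega), Rm _ _ (by omega)]
    by_cases c2 : c + 2 = d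
    · exact ⟨1, by omega, Or.inl (.h1 (by omega))⟩
    · rcases Nat.mod_two_eq_zero_or_one c with h | h
      · exact ⟨3, by omega, Or.inr (.i3 (by omega))⟩
      · exact ⟨3, by omega, Or.inl (.i3 (by omega))⟩
  · intro c x hc hx
    by_cases c2 : c + 2 = d
    · rw [show c + 1 = d - 1 by omega, Rd, Pd, Rm c x (by omega)]
      have h1 := Pm c x (by omega) (by omega)
      have h2 := hJ x
      have h3 := hZ (J x)
      by_cases j0 : J x + 1 = L
      · exact ⟨0, by omega, Or.inr (.b0 (by omega))⟩
      by_cases j1 : J x + Y < L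
      · exact ⟨3, by omega, Or.inr (.b3 (by omega))⟩
      · exact ⟨4, by omega, Or.inr (.c4 (by omega))⟩
    have g2 := Pm (c + 1) x (by omega) (by omega)
    rw [Rm (c + 1) _ (by omega)]
    by_cases c0 : c = 0
    · subst c0
      rw [R0, P0]
      have h1 := hA x
      by_cases x0 : x = 0
      · subst x0
        by_cases d3 : d = 3
        · exact ⟨3, by omega, Or.inl (.a3 (by omega))⟩
        · exact ⟨1, by omega, Or.inl (.a1 (by omega))⟩
      by_cases x1 : L ≤ x + 2
      · exact ⟨4, by omega, Or.inl (.a4 (by omega))⟩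
      · exact ⟨2, by omega, Or.inl (.a2 (by omega))⟩
    have g1 := Pm c x (by omega) (by omega)
    rw [Rm c _ (by omega)]
    rcases Nat.mod_two_eq_zero_or_one c with h | h
    · by_cases x1 : L ≤ x + 2
      · exact ⟨4, by omega, Or.inl (.b4 (by omega))⟩
      by_cases x0 : 0 < x ∨ c + 3 = d
      · exact ⟨2, by omega, Or.inl (.b2 (by omega))⟩
      · exact ⟨1, by omega, Or.inl (.b1 (by omega))⟩
    · exact ⟨0, by omega, Or.inl (.a0 (by omega))⟩
  · intro x hx
    have h2 := hJ (x + Y)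
    rw [R0, P0, Rd, Pd, show J (x + Y) = x by omega]
    exact rung x (by omega)
  · intro x hx hx'
    have h2 := hJ (x + Y - L)
    rw [R0, P0, Rd, Pd, show J (x + Y - L) = x by omega]
    exact rung x (by omega)

theorem oddCase (n k : ℕ) (hn : 5 ≤ n) (hk : 2 ≤ k) (hk' : k ≤ n / 2) (ho : n % 2 = 1) :
    HasMBE (circ n k) 5 := by
  by_cases hc : Nat.gcd n k = 1
  · exact scheme2 n k hn hk hk' ho (by rw [Nat.coprime_comm]; exact hc)
  obtain ⟨d, hd⟩ : ∃ d, d = Nat.gcd n k := ⟨_, rfl⟩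
  obtain ⟨L, hL⟩ : d ∣ n := hd ▸ Nat.gcd_dvd_left n k
  obtain ⟨t, ht⟩ : d ∣ k := hd ▸ Nat.gcd_dvd_right n k
  have hdL : d % 2 = 1 ∧ L % 2 = 1 := by
    have := Nat.odd_mul.1 (hL ▸ Nat.odd_iff.2 ho)
    exact ⟨Nat.odd_iff.1 this.1, Nat.odd_iff.1 this.2⟩
  have hd3 : 3 ≤ d := by omega
  have t0 : 0 < t := by
    rcases Nat.eq_zero_or_pos t with h | h
    · subst h; omega
    · exact h
  have hdk : d ≤ k := by rw [ht]; exact Nat.le_mul_of_pos_right _ t0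
  have hL3 : 3 ≤ L := by
    rcases (by omega : L = 1 ∨ 3 ≤ L) with h | h
    · subst h; omega
    · exact h
  obtain ⟨Y, hY0, hYL, hY, c1, c2⟩ := torus_main n k d L hd hL (by omega) (by omega)
  have hdvd : n ∣ d + Y * k := by
    rw [← ZMod.natCast_eq_zero_iff]; push_cast; exact hY
  by_cases hkd : k = d
  · have : L ∣ 1 + Y := by
      rw [hL, hkd, show d + Y * d = d * (1 + Y) by ring] at hdvd
      exact Nat.dvd_of_mul_dvd_mul_left (by omega) hdvd
    have := Nat.le_of_dvd (by omega) this
    obtain rfl : Y = L - 1 := by omega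
    exact c1 5 (by omega) (torus5 d L hdL.1 hd3 hdL.2 hL3)
  · have y1 : Y ≠ 1 := by
      rintro rfl
      have := Nat.le_of_dvd (by omega) hdvd
      omega
    have y2 : Y ≠ L - 1 := by
      intro h
      have h3 : n ∣ L * k := ⟨t, by rw [hL, ht]; ring⟩
      have h4 : L * k = Y * k + k := by
        rw [show L = Y + 1 by omega]; ring
      have h5 : n ∣ k - d := by
        have := (Nat.dvd_sub h3 hdvd)
        rwa [h4, show Y * k + k - (d + Y * k) = k - d by omega] at this
      have := Nat.le_of_dvd (by omega) h5
      omega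
    by_cases y3 : Y = 2
    · exact c2 5 (by omega) (torus4 d L (L - Y) hdL.1 hd3 hdL.2 (by omega) (by omega))
    · exact c1 5 (by omega) (torus4 d L Y hdL.1 hd3 hdL.2 (by omega) (by omega))

theorem evenCase (n k : ℕ) (hn : 5 ≤ n) (hk : 2 ≤ k) (hk' : k ≤ n / 2) (ho : n % 2 = 0)
    (he : k % 2 = 0) : HasMBE (circ n k) (Dg n k + 1) := by
  obtain ⟨d, hd⟩ : ∃ d, d = Nat.gcd n k := ⟨_, rfl⟩
  have hd2 : d % 2 = 0 := by
    have : 2 ∣ d := hd ▸ Nat.dvd_gcd (Nat.dvd_of_mod_eq_zero ho) (Nat.dvd_of_mod_eq_zero he)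
    omega
  have hd0 : 0 < d := hd ▸ Nat.gcd_pos_of_pos_left _ (by omega)
  obtain ⟨L, hL⟩ : d ∣ n := hd ▸ Nat.gcd_dvd_left n k
  obtain ⟨t, ht⟩ : d ∣ k := hd ▸ Nat.gcd_dvd_right n k
  have hdk : d ≤ k := Nat.le_of_dvd (by omega) ⟨t, ht⟩
  have hL2 : 2 ≤ L := by
    rcases (by omega : L = 0 ∨ L = 1 ∨ 2 ≤ L) with h | h | h
    · subst h; omega
    · subst h; omega
    · exact h
  obtain ⟨Y, hY0, hYL, hY, c1, c2⟩ := torus_main n k d L hd hL hL2 (by omega)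
  by_cases h : L = 2
  · subst h
    obtain rfl : Y = 1 := by omega
    have : Dg n k = 3 := if_pos (by omega)
    rw [this]
    exact c1 4 (by omega) (torus3b d hd2 hd0)
  · have : Dg n k = 4 := by
      apply if_neg
      intro h2
      have : d = k := by rw [hd, h2, Nat.gcd_mul_left_left]
      subst this
      exact h (Nat.eq_of_mul_eq_mul_left hd0 (by rw [← hL, h2, mul_comm]))
    rw [this]
    by_cases h2 : 2 * Y ≤ L
    · exact c1 5 (by omega) (torus3 d L Y hd2 hd0 (by omega) hY0 h2)
    · exact c2 5 (by omega) (torus3 d L (L - Y) hd2 hd0 (by omega) (by omega) (by omega))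

theorem stmt19 (n k : ℕ) (hn : 5 ≤ n) (hk : 2 ≤ k) (hk' : k ≤ n / 2) :
    (Even n ∧ Odd k → mbt (circ n k) = maxDeg (circ n k)) ∧
    (¬(Even n ∧ Odd k) → mbt (circ n k) = maxDeg (circ n k) + 1) ∧
    (mbt (circ n k) = maxDeg (circ n k) ↔ Even n ∧ Odd k) := by
  apply final_of n k hn hk hk'
  · rintro ⟨h1, h2⟩
    exact scheme1 n k hn hk hk' (Nat.even_iff.1 h1) (Nat.odd_iff.1 h2)
  · intro h
    rw [Nat.even_iff, Nat.odd_iff] at h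
    rcases Nat.mod_two_eq_zero_or_one n with hn2 | hn2
    · exact evenCase n k hn hk hk' hn2 (by omega)
    · have : Dg n k = 4 := if_neg (by omega)
      rw [this]
      exact oddCase n k hn hk hk' hn2
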